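/- arXiv:2504.14551 — 3 statements merged into one kernel-verified Lean document; each statement's English description precedes it below -/
import Mathlib

section
/- Let u, v be complex numbers with Re(u) > -1, Re(v) > -1, Re(u+v) > 0, u ≠ 1, v ≠ 1 and u+v ≠ 2. Then ζ(u)ζ(v) − (1/(u−1) + 1/(v−1)) ζ(u+v−1) = 2(2π)^{u−1} Σ_{n=1}^∞ σ_{1−u−v}(n) n^{u−1} · u · ∫_{2πn}^∞ t^{−u−1} sin t dt + 2(2π)^{v−1} Σ_{n=1}^∞ σ_{1−u−v}(n) n^{v−1} · v · ∫_{2πn}^∞ t^{−v−1} sin t dt. -/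
open Complex Real Filter MeasureTheory

/-- `σ_z(n) = ∑_{d ∣ n} d^z`. -/
noncomputable def sigmaZ (z : ℂ) (n : ℕ) : ℂ :=
  ∑ d ∈ n.divisors, (d : ℂ) ^ z

/-- The improper Riemann integral `∫_{2πn}^∞ t^{-u-1} sin t dt`, as the limit of
`∫_{2πn}^T t^{-u-1} sin t dt` as `T → ∞`. -/
noncomputable def wiltonIntegral (u : ℂ) (n : ℕ) : ℂ :=
  limUnder Filter.atTop
    (fun T : ℝ => ∫ t in (2 * π * n)..T, (t : ℂ) ^ (-u - 1) * Real.sin t)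

open Set Topology

/-- The periodized second Bernoulli polynomial `B₂({y})`. -/
noncomputable def fractBernoulliTwo (y : ℝ) : ℝ := Int.fract y ^ 2 - Int.fract y + 1 / 6

/-- The remainder in the second-order Euler–Maclaurin formula for `∑_{n > m} n^{-s}`. -/
noncomputable def zetaTailRemainder (s : ℂ) (m : ℕ) : ℂ :=
  s / 12 * (m : ℂ) ^ (-s - 1) -
    s * (s + 1) / 2 * ∫ y in Ioi (m : ℝ), (y : ℂ) ^ (-s - 2) * fractBernoulliTwo y

lemma measurable_fractBernoulliTwo : Measurable fractBernoulliTwo := by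
  unfold fractBernoulliTwo
  fun_prop

lemma abs_fractBernoulliTwo_le (y : ℝ) : |fractBernoulliTwo y| ≤ 1 := by
  have h0 := Int.fract_nonneg y
  have h1 := Int.fract_lt_one y
  unfold fractBernoulliTwo
  rw [abs_le]
  constructor <;> nlinarith

lemma fractBernoulliTwo_eq {m : ℕ} {y : ℝ} (hy : y ∈ Icc (m : ℝ) (m + 1)) :
    fractBernoulliTwo y = (y - m) ^ 2 - (y - m) + 1 / 6 := by
  unfold fractBernoulliTwo
  rcases hy.2.eq_or_lt with h | h
  · have : Int.fract y = 0 := by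
      rw [h]; simp
    rw [this, h]; ring
  · have : Int.fract y = y - m := by
      rw [Int.fract_eq_iff]
      exact ⟨by linarith [hy.1], by linarith, m, by simp⟩
    rw [this]

lemma hasSum_cos_div_sq (y : ℝ) :
    HasSum (fun k : ℕ+ => 1 / (k : ℝ) ^ 2 * Real.cos (2 * π * k * y))
      (π ^ 2 * fractBernoulliTwo y) := by
  have h := hasSum_one_div_nat_pow_mul_cos one_ne_zero
    (x := Int.fract y) ⟨Int.fract_nonneg y, (Int.fract_lt_one y).le⟩
  have hB : ((Polynomial.bernoulli (2 * 1)).map (algebraMap ℚ ℝ)).eval (Int.fract y) =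
      fractBernoulliTwo y := by
    simp only [Polynomial.bernoulli, Finset.sum_range_succ, mul_one, Finset.sum_range_zero,
      Polynomial.map_add, Polynomial.eval_add, fractBernoulliTwo]
    simp [bernoulli_one, bernoulli_two]
    ring
  rw [hB] at h
  have h' : HasSum (fun n : ℕ => 1 / (n : ℝ) ^ 2 * Real.cos (2 * π * n * y))
      (π ^ 2 * fractBernoulliTwo y) := by
    convert! h using 1
    · ext n
      rw [mul_one]
      congr 1
      have : 2 * π * n * y = 2 * π * n * Int.fract y + ((n * ⌊y⌋ : ℤ) : ℝ) * (2 * π) := by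
        conv_lhs => rw [← Int.floor_add_fract y]
        push_cast; ring
      rw [this, Real.cos_add_int_mul_two_pi]
    · rw [show Nat.factorial (2 * 1) = 2 from rfl]
      push_cast
      ring
  refine (Function.Injective.hasSum_iff PNat.coe_injective ?_).mpr h'
  intro n hn
  have : n = 0 := by
    by_contra h0
    exact hn ⟨⟨n, Nat.pos_of_ne_zero h0⟩, rfl⟩
  simp [this]

lemma hasDerivAt_ofReal_cpow (r : ℂ) {y : ℝ} (hy : 0 < y) :
    HasDerivAt (fun x : ℝ => (x : ℂ) ^ r) (r * (y : ℂ) ^ (r - 1)) y := by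
  have := ((hasDerivAt_id (y : ℂ)).cpow_const (c := r) (ofReal_mem_slitPlane.mpr hy)).comp_ofReal
  simpa using this

lemma integrableOn_cpow_mul {s : ℂ} (hs : -1 < s.re) {a : ℝ} (ha : 0 < a) {g : ℝ → ℝ}
    (hg : Measurable g) (hg1 : ∀ y, |g y| ≤ 1) :
    IntegrableOn (fun y : ℝ => (y : ℂ) ^ (-s - 2) * g y) (Ioi a) := by
  have h : IntegrableOn (fun y : ℝ => (y : ℂ) ^ (-s - 2)) (Ioi a) :=
    integrableOn_Ioi_cpow_of_lt (by simp; linarith) ha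
  refine h.mul_bdd (c := 1) (by fun_prop) (ae_of_all _ fun y => ?_)
  simpa using hg1 y

lemma norm_integral_cpow_mul_le {s : ℂ} (hs : -1 < s.re) {a : ℝ} (ha : 0 < a) {g : ℝ → ℝ}
    (hg1 : ∀ y, |g y| ≤ 1) :
    ‖∫ y in Ioi a, (y : ℂ) ^ (-s - 2) * g y‖ ≤ a ^ (-s.re - 1) / (s.re + 1) := by
  have hlt : -s.re - 2 < -1 := by linarith
  calc _ ≤ ∫ y in Ioi a, y ^ (-s.re - 2) := by
        refine norm_integral_le_of_norm_le (integrableOn_Ioi_rpow_of_lt hlt ha) ?_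
        filter_upwards [ae_restrict_mem measurableSet_Ioi] with y hy
        have hy0 : 0 < y := ha.trans hy
        rw [norm_mul, norm_cpow_eq_rpow_re_of_pos hy0]
        simp only [norm_real, Real.norm_eq_abs]
        have : (-s - 2 : ℂ).re = -s.re - 2 := by simp
        rw [this]
        exact mul_le_of_le_one_right (by positivity) (hg1 y)
    _ = _ := by
        rw [integral_Ioi_rpow_of_lt hlt ha, show -s.re - 2 + 1 = -(s.re + 1) by ring,
          neg_div_neg_eq, show -s.re - 1 = -(s.re + 1) by ring]

lemma norm_zetaTailRemainder_le {s : ℂ} (hs : -1 < s.re) {m : ℕ} (hm : 0 < m) :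
    ‖zetaTailRemainder s m‖ ≤
      (‖s / 12‖ + ‖s * (s + 1) / 2‖ / (s.re + 1)) * (m : ℝ) ^ (-s.re - 1) := by
  unfold zetaTailRemainder
  have hm' : (0 : ℝ) < m := by exact_mod_cast hm
  refine (norm_sub_le _ _).trans ?_
  rw [add_mul, norm_mul, norm_mul, norm_natCast_cpow_of_pos hm]
  have : (-s - 1 : ℂ).re = -s.re - 1 := by simp
  rw [this]
  have h := norm_integral_cpow_mul_le hs hm' abs_fractBernoulliTwo_le
  gcongr ?_ + ?_
  · exact le_rfl
  · calc _ ≤ ‖s * (s + 1) / 2‖ * ((m : ℝ) ^ (-s.re - 1) / (s.re + 1)) := by gcongr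
      _ = _ := by ring

/-- One step of the Euler–Maclaurin formula. -/
lemma zetaTailRemainder_sub_succ {s : ℂ} (hs : -1 < s.re) (hs1 : s ≠ 1) {m : ℕ} (hm : 0 < m) :
    zetaTailRemainder s m - zetaTailRemainder s (m + 1) =
      ((m : ℂ) ^ (-s) + ((m + 1 : ℕ) : ℂ) ^ (-s)) / 2 -
        ((m : ℂ) ^ (1 - s) - ((m + 1 : ℕ) : ℂ) ^ (1 - s)) / (s - 1) := by
  have hm' : (0 : ℝ) < m := by exact_mod_cast hm
  have h1s : 1 - s ≠ 0 := sub_ne_zero.mpr hs1.symm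
  have h1s' : s - 1 ≠ 0 := sub_ne_zero.mpr hs1
  have hInt := integrableOn_cpow_mul hs hm' measurable_fractBernoulliTwo abs_fractBernoulliTwo_le
  have hsplit : (∫ y in Ioi (m : ℝ), (y : ℂ) ^ (-s - 2) * fractBernoulliTwo y) -
      (∫ y in Ioi ((m + 1 : ℕ) : ℝ), (y : ℂ) ^ (-s - 2) * fractBernoulliTwo y) =
      ∫ y in (m : ℝ)..((m + 1 : ℕ) : ℝ), (y : ℂ) ^ (-s - 2) * fractBernoulliTwo y := by
    rw [intervalIntegral.integral_Ioi_sub_Ioi hInt (by simp)]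
  let G : ℝ → ℂ := fun y =>
    ((y - m : ℂ) ^ 2 - (y - m) + 1 / 6) * (-s * (y : ℂ) ^ (-s - 1)) -
      (2 * (y - m : ℂ) - 1) * (y : ℂ) ^ (-s) + 2 / (1 - s) * (y : ℂ) ^ (1 - s)
  have hG : ∀ y ∈ uIcc (m : ℝ) ((m + 1 : ℕ) : ℝ), HasDerivAt G
      (s * (s + 1) * ((y : ℂ) ^ (-s - 2) * fractBernoulliTwo y)) y := by
    intro y hy
    rw [uIcc_of_le (by simp)] at hy
    push_cast at hy
    have hy0 : 0 < y := hm'.trans_le hy.1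
    rw [fractBernoulliTwo_eq hy]
    have hlin : HasDerivAt (fun x : ℝ => (x - m : ℂ)) 1 y :=
      (hasDerivAt_id (y : ℂ)).comp_ofReal.sub_const _
    have h1 := ((hlin.pow 2).sub hlin).add_const (1 / 6 : ℂ)
    have h2 := (hasDerivAt_ofReal_cpow (-s - 1) hy0).const_mul (-s)
    have h3 := (hlin.const_mul 2).sub_const (1 : ℂ)
    have h4 := hasDerivAt_ofReal_cpow (-s) hy0
    have h5 := (hasDerivAt_ofReal_cpow (1 - s) hy0).const_mul (2 / (1 - s))
    convert! ((h1.mul h2).sub (h3.mul h4)).add h5 using 1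
    rw [show -s - 1 - 1 = -s - 2 by ring, show 1 - s - 1 = -s by ring]
    push_cast
    simp only [Pi.sub_apply, Pi.pow_apply]
    field_simp
    ring
  have hftc := intervalIntegral.integral_eq_sub_of_hasDerivAt hG (by
    apply IntervalIntegrable.const_mul
    rw [intervalIntegrable_iff_integrableOn_Ioc_of_le (by simp)]
    exact hInt.mono_set Ioc_subset_Ioi_self)
  rw [intervalIntegral.integral_const_mul, ← hsplit] at hftc
  simp only [G] at hftc
  push_cast at hftc
  unfold zetaTailRemainder
  push_cast
  have h12 : 2 / (1 - s) = - (2 / (s - 1)) := by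
    rw [← neg_sub s 1, div_neg]
  rw [h12] at hftc
  generalize (∫ y in Ioi (m : ℝ), (y : ℂ) ^ (-s - 2) * fractBernoulliTwo y) = A at *
  generalize (∫ y in Ioi (m + 1 : ℝ), (y : ℂ) ^ (-s - 2) * fractBernoulliTwo y) = B at *
  linear_combination (-1 / 2) * hftc

/-- The tail of the zeta series beyond `m`, continued to `ℂ`, with its first two asymptotic terms
removed. -/
noncomputable def zetaTailError (s : ℂ) (m : ℕ) : ℂ :=
  riemannZeta s - ∑ n ∈ Finset.range m, ((n + 1 : ℕ) : ℂ) ^ (-s) -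
    (m : ℂ) ^ (1 - s) / (s - 1) + (m : ℂ) ^ (-s) / 2

lemma zetaTailError_sub_zetaTailRemainder {s : ℂ} (hs : -1 < s.re) (hs1 : s ≠ 1) (m : ℕ) :
    zetaTailError s (m + 1) - zetaTailRemainder s (m + 1) =
      zetaTailError s 1 - zetaTailRemainder s 1 := by
  induction m with
  | zero => rfl
  | succ m ih =>
    rw [← ih]
    have h := zetaTailRemainder_sub_succ hs hs1 (Nat.succ_pos m)
    unfold zetaTailError
    rw [Finset.sum_range_succ _ (m + 1)]
    simp only [Nat.succ_eq_add_one] at h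
    linear_combination h

lemma tendsto_natCast_cpow_zero {s : ℂ} (hs : s.re < 0) :
    Tendsto (fun m : ℕ => ((m + 1 : ℕ) : ℂ) ^ s) atTop (𝓝 0) := by
  rw [tendsto_zero_iff_norm_tendsto_zero]
  have h := ((tendsto_rpow_neg_atTop (y := -s.re) (by linarith)).comp
    tendsto_natCast_atTop_atTop).comp (tendsto_add_atTop_nat 1)
  refine h.congr fun m => ?_
  simp only [Function.comp_apply, neg_neg]
  rw [norm_natCast_cpow_of_pos (Nat.succ_pos m)]

lemma tendsto_zetaTailRemainder {s : ℂ} (hs : -1 < s.re) :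
    Tendsto (fun m : ℕ => zetaTailRemainder s (m + 1)) atTop (𝓝 0) := by
  have h : Tendsto (fun m : ℕ => ((m + 1 : ℕ) : ℝ) ^ (-(s.re + 1))) atTop (𝓝 0) :=
    ((tendsto_rpow_neg_atTop (by linarith)).comp
      tendsto_natCast_atTop_atTop).comp (tendsto_add_atTop_nat 1)
  have h' := h.const_mul (‖s / 12‖ + ‖s * (s + 1) / 2‖ / (s.re + 1))
  rw [mul_zero] at h'
  refine squeeze_zero_norm (fun m => ?_) h'
  rw [neg_add']
  exact norm_zetaTailRemainder_le hs (Nat.succ_pos m)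

lemma tendsto_zetaTailError {s : ℂ} (hs : 1 < s.re) :
    Tendsto (fun m : ℕ => zetaTailError s (m + 1)) atTop (𝓝 0) := by
  have hsum : HasSum (fun n : ℕ => ((n + 1 : ℕ) : ℂ) ^ (-s)) (riemannZeta s) := by
    rw [zeta_eq_tsum_one_div_nat_add_one_cpow hs]
    have : Summable fun n : ℕ => 1 / (n + 1 : ℂ) ^ s := by
      have := (summable_nat_add_iff 1).mpr (Complex.summable_one_div_nat_cpow.mpr hs)
      exact_mod_cast this
    convert! this.hasSum using 2 with n
    rw [cpow_neg, one_div]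
    push_cast
    rfl
  have h1 := hsum.tendsto_sum_nat.comp (tendsto_add_atTop_nat 1)
  have h2 := tendsto_natCast_cpow_zero (s := 1 - s) (by simp; linarith)
  have h3 := tendsto_natCast_cpow_zero (s := -s) (by simp; linarith)
  have := (((tendsto_const_nhds (x := riemannZeta s)).sub h1).sub (h2.div_const (s - 1))).add
    (h3.div_const 2)
  simpa [zetaTailError] using! this

lemma differentiableAt_zetaTailRemainder_one {s : ℂ} (hs : -1 < s.re) :
    DifferentiableAt ℂ (fun z => zetaTailRemainder z 1) s := by
  let f : ℝ → ℂ := (Ioi (1 : ℝ)).indicator fun y => (fractBernoulliTwo y : ℂ)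
  have hf1 : ∀ y, ‖f y‖ ≤ 1 := fun y => by
    refine (norm_indicator_le_norm_self _ _).trans ?_
    simpa using abs_fractBernoulliTwo_le y
  have hfm : Measurable f :=
    (measurable_ofReal.comp measurable_fractBernoulliTwo).indicator measurableSet_Ioi
  have hfl : LocallyIntegrable f := by
    refine (locallyIntegrable_const (1 : ℝ)).mono hfm.aestronglyMeasurable (ae_of_all _ fun y => ?_)
    simpa using hf1 y
  have hmellin : ∀ z : ℂ, ∫ y in Ioi ((1 : ℕ) : ℝ), (y : ℂ) ^ (-z - 2) * fractBernoulliTwo y =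
      mellin f (-z - 1) := by
    intro z
    rw [mellin, Nat.cast_one]
    have : ∀ y : ℝ, (y : ℂ) ^ (-z - 1 - 1) • f y =
        (Ioi (1 : ℝ)).indicator (fun y : ℝ => (y : ℂ) ^ (-z - 2) * fractBernoulliTwo y) y := by
      intro y
      rw [show -z - 1 - 1 = -z - 2 by ring, smul_eq_mul]
      by_cases hy : y ∈ Ioi (1 : ℝ) <;> simp [f, indicator, hy]
    simp_rw [this]
    rw [setIntegral_indicator measurableSet_Ioi]
    congr 2
    ext y
    simp
  have hd : DifferentiableAt ℂ (mellin f) (-s - 1) := by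
    refine mellin_differentiableAt_of_isBigO_rpow (a := 0) (b := -s.re - 2)
      (hfl.locallyIntegrableOn _) ?_ (by simp; linarith) ?_ (by simp)
    · refine Asymptotics.IsBigO.of_bound 1 (Eventually.of_forall fun y => ?_)
      simpa using hf1 y
    · refine Asymptotics.IsBigO.of_bound 1 ?_
      filter_upwards [Ioo_mem_nhdsGT (zero_lt_one' ℝ)] with y hy
      have : f y = 0 := indicator_of_notMem (by simpa using hy.2.le) _
      rw [this, norm_zero]
      positivity
  unfold zetaTailRemainder
  simp_rw [hmellin]
  have hd' : DifferentiableAt ℂ (fun z => mellin f (-z - 1)) s :=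
    hd.fun_comp' s (f := fun z : ℂ => -z - 1) (by fun_prop)
  have : DifferentiableAt ℂ (fun z : ℂ => z / 12 * ((1 : ℕ) : ℂ) ^ (-z - 1)) s := by
    simp only [Nat.cast_one, one_cpow]
    fun_prop
  exact this.sub (DifferentiableAt.mul (by fun_prop) hd')

lemma isPreconnected_halfPlane_diff_one : IsPreconnected ({s : ℂ | -1 < s.re} \ {1}) := by
  have hre : ∀ a b : ℝ, IsPreconnected {s : ℂ | a < s.re ∧ s.re < b} := fun a b =>
    ((convex_halfSpace_re_gt a).inter (convex_halfSpace_re_lt b)).isPreconnected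
  have hR : IsPreconnected {s : ℂ | 1 < s.re} := (convex_halfSpace_re_gt 1).isPreconnected
  have hU : IsPreconnected {s : ℂ | -1 < s.re ∧ 0 < s.im} :=
    ((convex_halfSpace_re_gt (-1)).inter (convex_halfSpace_im_gt 0)).isPreconnected
  have hL : IsPreconnected {s : ℂ | -1 < s.re ∧ s.im < 0} :=
    ((convex_halfSpace_re_gt (-1)).inter (convex_halfSpace_im_lt 0)).isPreconnected
  have h1 := hU.union (2 + I) (by simp; norm_num) (by simp) hR
  have h2 := h1.union (2 - I) (by simp) (by simp; norm_num) hL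
  have h3 := h2.union I (by simp) (by simp) (hre (-1) 1)
  convert! h3 using 1
  ext s
  simp only [Set.mem_sdiff, mem_ofPred_eq, mem_singleton_iff, mem_union]
  constructor
  · rintro ⟨hs, hs1⟩
    rcases lt_trichotomy s.im 0 with h | h | h
    · exact Or.inl (Or.inr ⟨hs, h⟩)
    · rcases lt_trichotomy s.re 1 with h' | h' | h'
      · exact Or.inr ⟨hs, h'⟩
      · exact absurd (Complex.ext (by simpa using h') (by simpa using h)) hs1
      · exact Or.inl (Or.inl (Or.inr h'))
    · exact Or.inl (Or.inl (Or.inl ⟨hs, h⟩))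
  · intro h
    refine ⟨by rcases h with ((⟨h, -⟩ | h) | ⟨h, -⟩) | ⟨h, -⟩ <;> linarith, ?_⟩
    rintro rfl
    simp at h

/-- The second-order Euler–Maclaurin formula for the zeta function on `Re s > -1`. -/
theorem zetaTailError_eq_zetaTailRemainder {s : ℂ} (hs : -1 < s.re) (hs1 : s ≠ 1) {m : ℕ}
    (hm : 0 < m) : zetaTailError s m = zetaTailRemainder s m := by
  have hopen : IsOpen ({s : ℂ | -1 < s.re} \ {1}) :=
    (isOpen_lt continuous_const continuous_re).sdiff isClosed_singleton
  have hE : DifferentiableOn ℂ (fun z => zetaTailError z 1) ({s : ℂ | -1 < s.re} \ {1}) := by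
    intro z hz
    unfold zetaTailError
    have hz1 : z - 1 ≠ 0 := sub_ne_zero.mpr hz.2
    have := differentiableAt_riemannZeta hz.2
    simp only [Nat.cast_one, one_cpow, Finset.sum_range_one, zero_add]
    refine DifferentiableAt.differentiableWithinAt ?_
    fun_prop (disch := assumption)
  have hRm : DifferentiableOn ℂ (fun z => zetaTailRemainder z 1) ({s : ℂ | -1 < s.re} \ {1}) :=
    fun z hz => (differentiableAt_zetaTailRemainder_one hz.1).differentiableWithinAt
  have hlarge : ∀ z : ℂ, 1 < z.re → zetaTailError z 1 = zetaTailRemainder z 1 := by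
    intro z hz
    have hz1 : z ≠ 1 := by rintro rfl; simp at hz
    have ht := (tendsto_zetaTailError hz).sub (tendsto_zetaTailRemainder (by linarith))
    simp_rw [zetaTailError_sub_zetaTailRemainder (by linarith : -1 < z.re) hz1] at ht
    simpa [sub_eq_zero] using tendsto_nhds_unique tendsto_const_nhds ht
  have h1 := (hE.analyticOnNhd hopen).eqOn_of_preconnected_of_eventuallyEq
    (hRm.analyticOnNhd hopen) isPreconnected_halfPlane_diff_one (z₀ := 2)
    (by norm_num) (by
      filter_upwards [(isOpen_lt continuous_const continuous_re).mem_nhds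
        (by norm_num : (1 : ℝ) < (2 : ℂ).re)] with z hz using hlarge z hz) ⟨hs, hs1⟩
  obtain ⟨k, rfl⟩ := Nat.exists_eq_add_one.mpr hm
  have h2 := zetaTailError_sub_zetaTailRemainder hs hs1 k
  rw [← sub_eq_zero, h2, sub_eq_zero]
  exact h1

lemma tendsto_cpow_mul_zetaTailRemainder {s a : ℂ} (hs : -1 < s.re) (ha : a.re < s.re + 1) :
    Tendsto (fun m : ℕ => ((m + 1 : ℕ) : ℂ) ^ a * zetaTailRemainder s (m + 1)) atTop (𝓝 0) := by
  have h : Tendsto (fun m : ℕ => ((m + 1 : ℕ) : ℝ) ^ (-(s.re + 1 - a.re))) atTop (𝓝 0) :=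
    ((tendsto_rpow_neg_atTop (by linarith)).comp
      tendsto_natCast_atTop_atTop).comp (tendsto_add_atTop_nat 1)
  have h' := h.const_mul (‖s / 12‖ + ‖s * (s + 1) / 2‖ / (s.re + 1))
  rw [mul_zero] at h'
  refine squeeze_zero_norm (fun m => ?_) h'
  have hm : (0 : ℝ) < (m + 1 : ℕ) := by positivity
  rw [norm_mul, norm_natCast_cpow_of_pos (Nat.succ_pos m),
    show -(s.re + 1 - a.re) = a.re + (-s.re - 1) by ring, Real.rpow_add hm, mul_left_comm]
  gcongr
  exact norm_zetaTailRemainder_le hs (Nat.succ_pos m)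

lemma sum_cpow_mul_zetaTailError (u v : ℂ) (M : ℕ) :
    ∑ m ∈ Finset.range M, (((m + 1 : ℕ) : ℂ) ^ (-v) * zetaTailError u (m + 1) +
      ((m + 1 : ℕ) : ℂ) ^ (-u) * zetaTailError v (m + 1)) =
      riemannZeta u * ∑ n ∈ Finset.range M, ((n + 1 : ℕ) : ℂ) ^ (-v) +
      riemannZeta v * ∑ n ∈ Finset.range M, ((n + 1 : ℕ) : ℂ) ^ (-u) -
      (∑ n ∈ Finset.range M, ((n + 1 : ℕ) : ℂ) ^ (-u)) *
        ∑ n ∈ Finset.range M, ((n + 1 : ℕ) : ℂ) ^ (-v) -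
      (1 / (u - 1) + 1 / (v - 1)) *
        ∑ n ∈ Finset.range M, ((n + 1 : ℕ) : ℂ) ^ (-(u + v - 1)) := by
  induction M with
  | zero => simp
  | succ M ih =>
    rw [Finset.sum_range_succ, ih]
    unfold zetaTailError
    simp only [Finset.sum_range_succ]
    have hM : ((M + 1 : ℕ) : ℂ) ≠ 0 := by exact_mod_cast Nat.succ_ne_zero M
    have h1 : ((M + 1 : ℕ) : ℂ) ^ (1 - u) * ((M + 1 : ℕ) : ℂ) ^ (-v) =
        ((M + 1 : ℕ) : ℂ) ^ (-(u + v - 1)) := by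
      rw [← cpow_add _ _ hM]; ring_nf
    have h2 : ((M + 1 : ℕ) : ℂ) ^ (1 - v) * ((M + 1 : ℕ) : ℂ) ^ (-u) =
        ((M + 1 : ℕ) : ℂ) ^ (-(u + v - 1)) := by
      rw [← cpow_add _ _ hM]; ring_nf
    linear_combination (-(u - 1)⁻¹) * h1 - (v - 1)⁻¹ * h2

lemma tendsto_sum_cpow_mul_zetaTailRemainder {u v : ℂ} (hu : -1 < u.re) (hv : -1 < v.re)
    (huv : 0 < (u + v).re) (hu1 : u ≠ 1) (hv1 : v ≠ 1) (huv2 : u + v ≠ 2) :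
    Tendsto (fun M : ℕ => ∑ m ∈ Finset.range (M + 1),
      (((m + 1 : ℕ) : ℂ) ^ (-v) * zetaTailRemainder u (m + 1) +
        ((m + 1 : ℕ) : ℂ) ^ (-u) * zetaTailRemainder v (m + 1))) atTop
      (𝓝 (riemannZeta u * riemannZeta v -
        (1 / (u - 1) + 1 / (v - 1)) * riemannZeta (u + v - 1))) := by
  rw [add_re] at huv
  have hw : -1 < (u + v - 1).re := by simp; linarith
  have hw1 : u + v - 1 ≠ 1 := fun h => huv2 (by linear_combination h)
  have hu1' : u - 1 ≠ 0 := sub_ne_zero.mpr hu1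
  have hv1' : v - 1 ≠ 0 := sub_ne_zero.mpr hv1
  have hw1' : u + v - 1 - 1 ≠ 0 := sub_ne_zero.mpr hw1
  have hRuRv := (tendsto_zetaTailRemainder hu).mul (tendsto_zetaTailRemainder hv)
  have hRu1 := tendsto_cpow_mul_zetaTailRemainder (s := u) (a := 1 - v) hu (by simp; linarith)
  have hRu2 := tendsto_cpow_mul_zetaTailRemainder (s := u) (a := -v) hu (by simp; linarith)
  have hRv1 := tendsto_cpow_mul_zetaTailRemainder (s := v) (a := 1 - u) hv (by simp; linarith)
  have hRv2 := tendsto_cpow_mul_zetaTailRemainder (s := v) (a := -u) hv (by simp; linarith)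
  have hRw := tendsto_zetaTailRemainder hw
  have hX := tendsto_natCast_cpow_zero (s := -u + -v) (by simp; linarith)
  have hlim := (((((((hRuRv.add (hRu1.mul_const (1 / (v - 1)))).sub (hRu2.mul_const (1 / 2))).add
    (hRv1.mul_const (1 / (u - 1)))).sub (hRv2.mul_const (1 / 2))).add
    (hX.mul_const (1 / 4))).sub (hRw.const_mul (1 / (u - 1) + 1 / (v - 1)))).const_sub
    (riemannZeta u * riemannZeta v - (1 / (u - 1) + 1 / (v - 1)) * riemannZeta (u + v - 1)))
  simp only [mul_zero, zero_mul, add_zero, sub_zero] at hlim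
  refine hlim.congr fun M => ?_
  have hsum : ∑ m ∈ Finset.range (M + 1),
      (((m + 1 : ℕ) : ℂ) ^ (-v) * zetaTailRemainder u (m + 1) +
        ((m + 1 : ℕ) : ℂ) ^ (-u) * zetaTailRemainder v (m + 1)) =
      ∑ m ∈ Finset.range (M + 1), (((m + 1 : ℕ) : ℂ) ^ (-v) * zetaTailError u (m + 1) +
        ((m + 1 : ℕ) : ℂ) ^ (-u) * zetaTailError v (m + 1)) := by
    refine Finset.sum_congr rfl fun m _ => ?_
    rw [zetaTailError_eq_zetaTailRemainder hu hu1 m.succ_pos,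
      zetaTailError_eq_zetaTailRemainder hv hv1 m.succ_pos]
  rw [hsum, sum_cpow_mul_zetaTailError]
  have eu := zetaTailError_eq_zetaTailRemainder hu hu1 M.succ_pos
  have ev := zetaTailError_eq_zetaTailRemainder hv hv1 M.succ_pos
  have ew := zetaTailError_eq_zetaTailRemainder hw hw1 M.succ_pos
  simp only [Nat.succ_eq_add_one] at eu ev ew
  rw [← eu, ← ev, ← ew]
  unfold zetaTailError
  generalize ∑ n ∈ Finset.range (M + 1), ((n + 1 : ℕ) : ℂ) ^ (-u) = Su
  generalize ∑ n ∈ Finset.range (M + 1), ((n + 1 : ℕ) : ℂ) ^ (-v) = Sv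
  generalize ∑ n ∈ Finset.range (M + 1), ((n + 1 : ℕ) : ℂ) ^ (-(u + v - 1)) = Sw
  have hM : ((M + 1 : ℕ) : ℂ) ≠ 0 := by exact_mod_cast M.succ_ne_zero
  generalize ((M + 1 : ℕ) : ℂ) = x at hM ⊢
  rw [show 1 - (u + v - 1) = 1 + 1 + -u + -v by ring, show -(u + v - 1) = 1 + -u + -v by ring,
    sub_eq_add_neg 1 u, sub_eq_add_neg 1 v]
  simp only [cpow_add _ _ hM, cpow_one]
  field_simp
  ring

lemma wiltonIntegral_eq {u : ℂ} (hu : -1 < u.re) {n : ℕ} (hn : 0 < n) :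
    wiltonIntegral u n = ((2 * π * n : ℝ) : ℂ) ^ (-u - 1) -
      (u + 1) * ∫ t in Ioi (2 * π * n : ℝ), (t : ℂ) ^ (-u - 2) * Real.cos t := by
  have hn' : (0 : ℝ) < n := by exact_mod_cast hn
  have ha : (0 : ℝ) < 2 * π * n := by positivity
  have hInt := integrableOn_cpow_mul hu ha Real.measurable_cos Real.abs_cos_le_one
  have hlim := (intervalIntegral_tendsto_integral_Ioi _ hInt tendsto_id).const_mul (u + 1)
  have hb : Tendsto (fun T : ℝ => (T : ℂ) ^ (-u - 1) * Real.cos T) atTop (𝓝 0) := by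
    refine squeeze_zero_norm' ?_ (tendsto_rpow_neg_atTop (y := u.re + 1) (by linarith))
    filter_upwards [eventually_gt_atTop 0] with T hT
    rw [norm_mul, norm_cpow_eq_rpow_re_of_pos hT]
    have : (-u - 1 : ℂ).re = -(u.re + 1) := by simp; ring
    rw [this, norm_real, Real.norm_eq_abs]
    exact mul_le_of_le_one_right (by positivity) (Real.abs_cos_le_one T)
  have htot := ((tendsto_const_nhds (x := ((2 * π * n : ℝ) : ℂ) ^ (-u - 1))).sub hb).sub hlim
  rw [sub_zero] at htot
  refine (htot.congr' ?_).limUnder_eq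
  filter_upwards [eventually_ge_atTop (2 * π * n)] with T hT
  have hpos : ∀ t ∈ uIcc (2 * π * n) T, 0 < t := fun t ht => by
    rw [uIcc_of_le hT] at ht
    exact ha.trans_le ht.1
  have hcont : ∀ r : ℂ, ContinuousOn (fun t : ℝ => (t : ℂ) ^ r) (uIcc (2 * π * n) T) :=
    fun r t ht => (hasDerivAt_ofReal_cpow r (hpos t ht)).continuousAt.continuousWithinAt
  have hI1 : IntervalIntegrable (fun t : ℝ => (t : ℂ) ^ (-u - 1) * Real.sin t) volume
      (2 * π * n) T :=
    ((hcont _).mul (by fun_prop)).intervalIntegrable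
  have hI2 : IntervalIntegrable (fun t : ℝ => (u + 1) * ((t : ℂ) ^ (-u - 2) * Real.cos t)) volume
      (2 * π * n) T :=
    (continuousOn_const.mul ((hcont _).mul (by fun_prop))).intervalIntegrable
  have hftc := intervalIntegral.integral_eq_sub_of_hasDerivAt
    (f := fun t : ℝ => -((t : ℂ) ^ (-u - 1) * Real.cos t))
    (f' := fun t : ℝ => (t : ℂ) ^ (-u - 1) * Real.sin t +
      (u + 1) * ((t : ℂ) ^ (-u - 2) * Real.cos t)) (fun t ht => by
      have := ((hasDerivAt_ofReal_cpow (-u - 1) (hpos t ht)).mul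
        (Real.hasDerivAt_cos t).ofReal_comp).neg
      convert! this using 1
      rw [show -u - 1 - 1 = -u - 2 by ring]
      push_cast
      ring) (hI1.add hI2)
  rw [intervalIntegral.integral_add hI1 hI2, intervalIntegral.integral_const_mul] at hftc
  have hcos : Real.cos (2 * π * n) = 1 := by
    rw [mul_comm]
    exact Real.cos_nat_mul_two_pi n
  simp only [hcos, ofReal_one, mul_one, id] at hftc ⊢
  linear_combination -hftc

/-- The normalised form of the integral `∫_{2πkm}^∞ t^{-u-1} sin t dt`. -/
noncomputable def wiltonKernel (u : ℂ) (m k : ℕ) : ℂ :=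
  (m : ℂ) ^ (-u - 1) -
    (u + 1) * ∫ y in Ioi (m : ℝ), (y : ℂ) ^ (-u - 2) * Real.cos (2 * π * k * y)

lemma norm_wiltonKernel_le {u : ℂ} (hu : -1 < u.re) {m : ℕ} (hm : 0 < m) (k : ℕ) :
    ‖wiltonKernel u m k‖ ≤ (1 + ‖u + 1‖ / (u.re + 1)) * (m : ℝ) ^ (-u.re - 1) := by
  unfold wiltonKernel
  have hm' : (0 : ℝ) < m := by exact_mod_cast hm
  refine (norm_sub_le _ _).trans ?_
  rw [norm_mul, add_mul _ _ ((m : ℝ) ^ (-u.re - 1)), norm_natCast_cpow_of_pos hm, one_mul]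
  have : (-u - 1 : ℂ).re = -u.re - 1 := by simp
  rw [this]
  have h := norm_integral_cpow_mul_le hu hm' (g := fun y => Real.cos (2 * π * k * y))
    fun y => Real.abs_cos_le_one _
  gcongr ?_ + ?_
  · exact le_rfl
  · calc _ ≤ ‖u + 1‖ * ((m : ℝ) ^ (-u.re - 1) / (u.re + 1)) := by gcongr
      _ = _ := by ring

lemma wiltonIntegral_mul {u : ℂ} (hu : -1 < u.re) {m k : ℕ} (hm : 0 < m) (hk : 0 < k) :
    wiltonIntegral u (m * k) = ((2 * π * k : ℝ) : ℂ) ^ (-u - 1) * wiltonKernel u m k := by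
  have hk' : (0 : ℝ) < k := by exact_mod_cast hk
  have hm' : (0 : ℝ) < m := by exact_mod_cast hm
  have hb : (0 : ℝ) < 2 * π * k := by positivity
  have hbc : ((2 * π * k : ℝ) : ℂ) ≠ 0 := ofReal_ne_zero.mpr hb.ne'
  rw [wiltonIntegral_eq hu (Nat.mul_pos hm hk), wiltonKernel]
  have hcast : (2 * π * (m * k : ℕ) : ℝ) = 2 * π * k * m := by push_cast; ring
  rw [hcast]
  have hsub := integral_comp_mul_left_Ioi
    (fun t : ℝ => (t : ℂ) ^ (-u - 2) * Real.cos t) (m : ℝ) hb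
  have hcongr : ∫ y in Ioi (m : ℝ), ((2 * π * k * y : ℝ) : ℂ) ^ (-u - 2) *
      Real.cos (2 * π * k * y) = ((2 * π * k : ℝ) : ℂ) ^ (-u - 2) *
        ∫ y in Ioi (m : ℝ), (y : ℂ) ^ (-u - 2) * Real.cos (2 * π * k * y) := by
    rw [← integral_const_mul]
    refine setIntegral_congr_fun measurableSet_Ioi fun y hy => ?_
    have hy0 : 0 < y := hm'.trans hy
    rw [ofReal_mul (2 * π * k) y, mul_cpow_ofReal_nonneg hb.le hy0.le, mul_assoc]
  rw [hcongr, Complex.real_smul, ofReal_inv] at hsub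
  have hpow : ((2 * π * k : ℝ) : ℂ) ^ (-u - 1) =
      ((2 * π * k : ℝ) : ℂ) ^ (-u - 2) * ((2 * π * k : ℝ) : ℂ) := by
    rw [show -u - 1 = -u - 2 + 1 by ring, cpow_add _ _ hbc, cpow_one]
  rw [ofReal_mul (2 * π * k) m, mul_cpow_ofReal_nonneg hb.le hm'.le, ofReal_natCast, hpow]
  field_simp at hsub
  linear_combination (-(u + 1)) * hsub.symm

lemma summable_pnat_one_div_sq : Summable fun k : ℕ+ => 1 / (k : ℝ) ^ 2 :=
  (Real.summable_one_div_nat_pow.mpr one_lt_two).comp_injective PNat.coe_injective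

lemma hasSum_integral_cos_div_sq {u : ℂ} (hu : -1 < u.re) {m : ℕ} (hm : 0 < m) :
    HasSum (fun k : ℕ+ => 1 / (k : ℂ) ^ 2 *
        ∫ y in Ioi (m : ℝ), (y : ℂ) ^ (-u - 2) * Real.cos (2 * π * k * y))
      ((π : ℂ) ^ 2 * ∫ y in Ioi (m : ℝ), (y : ℂ) ^ (-u - 2) * fractBernoulliTwo y) := by
  have hm' : (0 : ℝ) < m := by exact_mod_cast hm
  let F : ℕ+ → ℝ → ℂ := fun k y =>
    1 / (k : ℂ) ^ 2 * ((y : ℂ) ^ (-u - 2) * Real.cos (2 * π * k * y))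
  have hF : ∀ k, IntegrableOn (F k) (Ioi (m : ℝ)) := fun k =>
    (integrableOn_cpow_mul hu hm' (g := fun y => Real.cos (2 * π * k * y)) (by fun_prop)
      fun y => Real.abs_cos_le_one _).const_mul _
  have hlt : (-u - 2 : ℂ).re < -1 := by simp; linarith
  have hnorm : IntegrableOn (fun y : ℝ => ‖(y : ℂ) ^ (-u - 2)‖) (Ioi (m : ℝ)) :=
    (integrableOn_Ioi_cpow_of_lt hlt hm').norm
  have hsummable : Summable fun k => ∫ y in Ioi (m : ℝ), ‖F k y‖ := by
    refine (summable_pnat_one_div_sq.mul_right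
      (∫ y in Ioi (m : ℝ), ‖(y : ℂ) ^ (-u - 2)‖)).of_nonneg_of_le
      (fun k => integral_nonneg fun y => norm_nonneg _) fun k => ?_
    rw [← integral_const_mul]
    refine integral_mono (hF k).norm (hnorm.const_mul _) fun y => ?_
    simp only [F]
    rw [norm_mul, norm_mul, norm_real, Real.norm_eq_abs]
    have : ‖(1 / (k : ℂ) ^ 2 : ℂ)‖ = 1 / (k : ℝ) ^ 2 := by simp
    rw [this]
    gcongr
    exact mul_le_of_le_one_right (norm_nonneg _) (Real.abs_cos_le_one _)
  have h := hasSum_integral_of_summable_integral_norm hF hsummable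
  convert! h using 1
  · ext k
    rw [integral_const_mul]
  · rw [← integral_const_mul]
    congr 1
    ext y
    have hy := (ofRealCLM.hasSum (hasSum_cos_div_sq y)).mul_left ((y : ℂ) ^ (-u - 2))
    have := hy.tsum_eq
    simp only [ofRealCLM_apply] at this
    rw [mul_left_comm, ← ofReal_pow, ← ofReal_mul, ← this]
    refine tsum_congr fun k => ?_
    simp only [F]
    push_cast
    ring

lemma hasSum_wiltonKernel {u : ℂ} (hu : -1 < u.re) {m : ℕ} (hm : 0 < m) :
    HasSum (fun k : ℕ+ => u / (2 * (π : ℂ) ^ 2) * (1 / (k : ℂ) ^ 2 * wiltonKernel u m k))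
      (zetaTailRemainder u m) := by
  have h1 : HasSum (fun k : ℕ+ => 1 / (k : ℂ) ^ 2) ((π : ℂ) ^ 2 / 6) := by
    have := ofRealCLM.hasSum (hasSum_cos_div_sq 0)
    convert! this using 1
    · ext k; simp
    · simp [fractBernoulliTwo]
      ring
  have h := ((h1.mul_right ((m : ℂ) ^ (-u - 1))).sub
    ((hasSum_integral_cos_div_sq hu hm).mul_left (u + 1))).mul_left (u / (2 * (π : ℂ) ^ 2))
  have hpi : (π : ℂ) ≠ 0 := ofReal_ne_zero.mpr Real.pi_ne_zero
  convert! h using 1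
  · ext k
    rw [wiltonKernel]
    ring
  · rw [zetaTailRemainder]
    field_simp
    ring

lemma summable_cpow_mul_wiltonKernel {u v : ℂ} (hu : -1 < u.re) (huv : 0 < (u + v).re) :
    Summable fun p : ℕ+ × ℕ+ => (p.1 : ℂ) ^ (-v) *
      (u / (2 * (π : ℂ) ^ 2) * (1 / (p.2 : ℂ) ^ 2 * wiltonKernel u p.1 p.2)) := by
  rw [add_re] at huv
  have hs : Summable fun m : ℕ+ => (m : ℝ) ^ (-v.re + (-u.re - 1)) :=
    (Real.summable_nat_rpow.mpr (by linarith)).comp_injective PNat.coe_injective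
  have hp := (hs.mul_of_nonneg summable_pnat_one_div_sq (fun m => by positivity)
    (fun k => by positivity)).mul_left (‖u / (2 * (π : ℂ) ^ 2)‖ * (1 + ‖u + 1‖ / (u.re + 1)))
  refine hp.of_norm_bounded fun p => ?_
  have h := norm_wiltonKernel_le hu p.1.pos p.2
  have hm : (0 : ℝ) < p.1 := by exact_mod_cast p.1.pos
  have hk : ‖(1 / (p.2 : ℂ) ^ 2 : ℂ)‖ = 1 / (p.2 : ℝ) ^ 2 := by simp
  rw [norm_mul, norm_mul, norm_mul, hk, norm_natCast_cpow_of_pos p.1.pos, neg_re,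
    Real.rpow_add hm]
  calc _ ≤ (p.1 : ℝ) ^ (-v.re) * (‖u / (2 * (π : ℂ) ^ 2)‖ * (1 / (p.2 : ℝ) ^ 2 *
        ((1 + ‖u + 1‖ / (u.re + 1)) * (p.1 : ℝ) ^ (-u.re - 1)))) := by gcongr
    _ = _ := by ring

lemma sigmaZ_mul_wiltonIntegral {u v : ℂ} (hu : -1 < u.re) {n : ℕ} (hn : 0 < n) :
    2 * (2 * π : ℂ) ^ (u - 1) * (sigmaZ (1 - u - v) n * (n : ℂ) ^ (u - 1) * u *
        wiltonIntegral u n) =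
      ∑ x ∈ n.divisorsAntidiagonal, (x.1 : ℂ) ^ (-v) *
        (u / (2 * (π : ℂ) ^ 2) * (1 / (x.2 : ℂ) ^ 2 * wiltonKernel u x.1 x.2)) := by
  have hsigma : sigmaZ (1 - u - v) n =
      ∑ x ∈ n.divisorsAntidiagonal, (x.1 : ℂ) ^ (1 - u - v) :=
    (Nat.sum_divisorsAntidiagonal (fun d _ => (d : ℂ) ^ (1 - u - v))).symm
  rw [hsigma, Finset.sum_mul, Finset.sum_mul, Finset.sum_mul, Finset.mul_sum]
  refine Finset.sum_congr rfl fun x hx => ?_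
  obtain ⟨m, k⟩ := x
  obtain ⟨rfl, -⟩ := Nat.mem_divisorsAntidiagonal.mp hx
  have hm : 0 < m := Nat.pos_of_mul_pos_right hn
  have hk : 0 < k := Nat.pos_of_mul_pos_left hn
  have hmc : (m : ℂ) ≠ 0 := by exact_mod_cast hm.ne'
  have hkc : (k : ℂ) ≠ 0 := by exact_mod_cast hk.ne'
  have hpi : (π : ℂ) ≠ 0 := ofReal_ne_zero.mpr Real.pi_ne_zero
  have h2pi : (2 * π : ℂ) ≠ 0 := mul_ne_zero two_ne_zero hpi
  rw [wiltonIntegral_mul hu hm hk]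
  have hpow : ((2 * π * k : ℝ) : ℂ) ^ (-u - 1) = (2 * π : ℂ) ^ (-u - 1) * (k : ℂ) ^ (-u - 1) := by
    rw [ofReal_mul (2 * π) k, mul_cpow_ofReal_nonneg (by positivity) (by positivity)]
    push_cast
    rfl
  have e1 : (2 * π : ℂ) ^ (u - 1) * (2 * π : ℂ) ^ (-u - 1) = ((2 * π : ℂ) ^ 2)⁻¹ := by
    rw [← cpow_add _ _ h2pi, show u - 1 + (-u - 1) = -((2 : ℕ) : ℂ) by push_cast; ring, cpow_neg,
      cpow_natCast]
  have e2 : (k : ℂ) ^ (u - 1) * (k : ℂ) ^ (-u - 1) = ((k : ℂ) ^ 2)⁻¹ := by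
    rw [← cpow_add _ _ hkc, show u - 1 + (-u - 1) = -((2 : ℕ) : ℂ) by push_cast; ring, cpow_neg,
      cpow_natCast]
  have e3 : (m : ℂ) ^ (1 - u - v) * (m : ℂ) ^ (u - 1) = (m : ℂ) ^ (-v) := by
    rw [← cpow_add _ _ hmc]; ring_nf
  rw [hpow, Nat.cast_mul, natCast_mul_natCast_cpow]
  calc _ = 2 * ((2 * π : ℂ) ^ (u - 1) * (2 * π : ℂ) ^ (-u - 1)) *
        ((m : ℂ) ^ (1 - u - v) * (m : ℂ) ^ (u - 1)) *
        ((k : ℂ) ^ (u - 1) * (k : ℂ) ^ (-u - 1)) * u * wiltonKernel u m k := by ring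
    _ = _ := by
      rw [e1, e2, e3]
      field_simp

/-- The divisor series in Wilton's formula, as a series over the first divisor. -/
lemma hasSum_cpow_mul_zetaTailRemainder {u v : ℂ} (hu : -1 < u.re) (huv : 0 < (u + v).re) :
    HasSum (fun m : ℕ => ((m + 1 : ℕ) : ℂ) ^ (-v) * zetaTailRemainder u (m + 1))
      (2 * (2 * π : ℂ) ^ (u - 1) *
        ∑' n : ℕ, sigmaZ (1 - u - v) (n + 1) * ((n : ℂ) + 1) ^ (u - 1) * u *
          wiltonIntegral u (n + 1)) := by
  have hS := summable_cpow_mul_wiltonKernel hu huv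
  have hrows := hS.hasSum.prod_fiberwise fun m : ℕ+ =>
    (hasSum_wiltonKernel hu m.pos).mul_left ((m : ℂ) ^ (-v))
  have hdiv := (sigmaAntidiagonalEquivProd.hasSum_iff.mpr hS.hasSum).sigma (γ := fun n : ℕ+ =>
    (n : ℕ).divisorsAntidiagonal) fun n => hasSum_fintype _
  have hterm : ∀ n : ℕ+, 2 * (2 * π : ℂ) ^ (u - 1) * (sigmaZ (1 - u - v) n * (n : ℂ) ^ (u - 1) *
      u * wiltonIntegral u n) = ∑ x : (n : ℕ).divisorsAntidiagonal,
        ((x.1.1 : ℕ) : ℂ) ^ (-v) * (u / (2 * (π : ℂ) ^ 2) *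
          (1 / ((x.1.2 : ℕ) : ℂ) ^ 2 * wiltonKernel u x.1.1 x.1.2)) := fun n => by
    rw [sigmaZ_mul_wiltonIntegral hu n.pos]
    exact (Finset.sum_coe_sort (n : ℕ).divisorsAntidiagonal fun x => (x.1 : ℂ) ^ (-v) *
      (u / (2 * (π : ℂ) ^ 2) * (1 / (x.2 : ℂ) ^ 2 * wiltonKernel u x.1 x.2))).symm
  have heq := hdiv.tsum_eq.symm.trans (tsum_congr fun n => (hterm n).symm)
  rw [tsum_pnat_eq_tsum_succ (f := fun n : ℕ => 2 * (2 * π : ℂ) ^ (u - 1) *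
    (sigmaZ (1 - u - v) n * (n : ℂ) ^ (u - 1) * u * wiltonIntegral u n)), tsum_mul_left] at heq
  rw [heq] at hrows
  rw [← Equiv.pnatEquivNat.symm.hasSum_iff] at hrows
  simpa [Function.comp_def] using hrows

/-- Wilton's formula for the Riemann zeta function. -/
theorem wilton_formula
    (u v : ℂ) (hu : -1 < u.re) (hv : -1 < v.re) (huv : 0 < (u + v).re)
    (hu1 : u ≠ 1) (hv1 : v ≠ 1) (huv2 : u + v ≠ 2) :
    riemannZeta u * riemannZeta v -
        (1 / (u - 1) + 1 / (v - 1)) * riemannZeta (u + v - 1) =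
      2 * (2 * π : ℂ) ^ (u - 1) *
          ∑' n : ℕ, sigmaZ (1 - u - v) (n + 1) * ((n : ℂ) + 1) ^ (u - 1) * u *
            wiltonIntegral u (n + 1)
      + 2 * (2 * π : ℂ) ^ (v - 1) *
          ∑' n : ℕ, sigmaZ (1 - u - v) (n + 1) * ((n : ℂ) + 1) ^ (v - 1) * v *
            wiltonIntegral v (n + 1) := by
  have huv' : 0 < (v + u).re := by rwa [add_comm]
  have h1 := hasSum_cpow_mul_zetaTailRemainder hu huv
  have h2 := hasSum_cpow_mul_zetaTailRemainder hv huv'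
  rw [show 1 - v - u = 1 - u - v by ring] at h2
  have h := (h1.add h2).tendsto_sum_nat.comp (tendsto_add_atTop_nat 1)
  exact tendsto_nhds_unique
    (tendsto_sum_cpow_mul_zetaTailRemainder hu hv huv hu1 hv1 huv2) h
end

section
/- Let λ > 0, k ∈ ℝ, γ ∈ ℂ, and let (α_n)_{n≥0}, (β_n)_{n≥0} be complex sequences with α_n = O(n^c) and β_n = O(n^c) for some c ≥ 0. Define φ(s) = Σ_{n≥1} α_n n^{−s}, ψ(s) = Σ_{n≥1} β_n n^{−s} (convergent for Re(s) > c+1), Φ(s) = (2π/λ)^{−s} Γ(s) φ(s), Ψ(s) = (2π/λ)^{−s} Γ(s) ψ(s), and for τ in the upper half-plane ℍ, f_α(τ) = Σ_{n≥0} α_n e^{2πinτ/λ} and f_β(τ) = Σ_{n≥0} β_n e^{2πinτ/λ}. Then the following are equivalent: (1) f_α(τ) = γ (τ/i)^{−k} f_β(−1/τ) for all τ ∈ ℍ; (2) the functions Φ(s) + α_0/s + γβ_0/(k−s) and Ψ(s) + β_0/s + α_0/(γ(k−s)) extend to entire functions on ℂ which are bounded in every vertical strip, and Φ(s) = γ Ψ(k−s)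 holds. -/
open Complex Real Filter MeasureTheory

/-- The Dirichlet series `∑_{n ≥ 1} α_n n^{-s}`. -/
noncomputable def dseries (α : ℕ → ℂ) (s : ℂ) : ℂ :=
  ∑' n : ℕ, α (n + 1) / ((n : ℂ) + 1) ^ s

/-- The completed Dirichlet series `Φ(s) = (2π/λ)^{-s} Γ(s) φ(s)`. -/
noncomputable def completed (lam : ℝ) (α : ℕ → ℂ) (s : ℂ) : ℂ :=
  ((2 * π / lam : ℝ) : ℂ) ^ (-s) * Complex.Gamma s * dseries α s


theorem integral_vertical_line_eq {J : ℂ → ℂ} (hJ : Differentiable ℂ J) {a b : ℝ} (hab : a ≤ b)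
    {B : ℝ → ℝ} (hB : Integrable B) (hB_top : Tendsto B atTop (nhds 0))
    (hB_bot : Tendsto B atBot (nhds 0))
    (hle : ∀ x ∈ Set.Icc a b, ∀ v : ℝ, ‖J (x + v * I)‖ ≤ B v) :
    ∫ v : ℝ, J (a + v * I) = ∫ v : ℝ, J (b + v * I) := by
  have hJc := hJ.continuous
  have hint : ∀ x ∈ Set.Icc a b, Integrable fun v : ℝ => J (x + v * I) := fun x hx =>
    hB.mono' (by fun_prop : Continuous fun v : ℝ => J (x + v * I)).aestronglyMeasurable
      (.of_forall (hle x hx))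
  have hlim : ∀ x ∈ Set.Icc a b, Tendsto (fun T : ℝ => ∫ v in -T..T, J (x + v * I)) atTop
      (nhds (∫ v : ℝ, J (x + v * I))) := fun x hx =>
    intervalIntegral_tendsto_integral (hint x hx) tendsto_neg_atTop_atBot tendsto_id
  have hhor : ∀ g : ℝ → ℝ, Tendsto (fun T => B (g T)) atTop (nhds 0) →
      Tendsto (fun T : ℝ => ∫ x in a..b, J (x + (g T : ℝ) * I)) atTop (nhds 0) := by
    intro g hg
    refine squeeze_zero_norm (a := fun T => B (g T) * |b - a|) (fun T => ?_)
      (by simpa using hg.mul_const |b - a|)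
    refine intervalIntegral.norm_integral_le_of_norm_le_const fun x hx => ?_
    rw [Set.uIoc_of_le hab] at hx
    exact hle x ⟨hx.1.le, hx.2⟩ _
  have htop := hhor id hB_top
  have hbot := hhor (fun T => -T) (hB_bot.comp tendsto_neg_atTop_atBot)
  have hsum := ((hbot.sub htop).add ((hlim b ⟨hab, le_rfl⟩).const_mul I)).sub
    ((hlim a ⟨le_rfl, hab⟩).const_mul I)
  have hzero : ∀ T : ℝ, (((∫ x in a..b, J (x + (-T : ℝ) * I)) - ∫ x in a..b, J (x + (id T : ℝ) * I)) +
      I * ∫ v in -T..T, J (b + v * I)) - I * ∫ v in -T..T, J (a + v * I) = 0 := by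
    intro T
    simpa using integral_boundary_rect_eq_zero_of_differentiableOn J (a + (-T : ℝ) * I)
      (b + (T : ℝ) * I) hJ.differentiableOn
  have := tendsto_nhds_unique hsum (by simpa only [hzero] using tendsto_const_nhds)
  have h2 : I * ((∫ v : ℝ, J (b + v * I)) - ∫ v : ℝ, J (a + v * I)) = 0 := by
    rw [← this]; ring
  exact (sub_eq_zero.mp ((mul_eq_zero.mp h2).resolve_left I_ne_zero)).symm

theorem integrable_gaussian_twist (σ w : ℝ) :
    Integrable fun v : ℝ => cexp ((σ + v * I) ^ 2 / 4 - (σ + v * I) * (w * I) / 2) := by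
  have := integrable_cexp_quadratic (b := 1 / 4) (by norm_num) (I * σ / 2 + w / 2)
    (σ ^ 2 / 4 - σ * w * I / 2)
  refine this.congr (.of_forall fun v => ?_)
  dsimp only
  congr 1
  linear_combination (-(v : ℂ) ^ 2 / 4 + v * w / 2) * I_sq

theorem integral_gaussian_twist (σ w u : ℝ) :
    ∫ v : ℝ, cexp ((σ + v * I) ^ 2 / 4 - (σ + v * I) * (w * I) / 2) * cexp (v * u * I) =
      (4 * π : ℂ) ^ (1 / 2 : ℂ) * cexp (-σ * u - u ^ 2 + w * I * u + w ^ 2 / 4) := by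
  have := integral_cexp_quadratic (b := -1 / 4) (by norm_num) (I * σ / 2 + w / 2 + u * I)
    (σ ^ 2 / 4 - σ * w * I / 2)
  convert this using 1
  · refine integral_congr_ae (.of_forall fun v => ?_)
    dsimp only
    rw [← Complex.exp_add]
    congr 1
    linear_combination ((v : ℂ) ^ 2 / 4 - v * w / 2) * I_sq
  · congr 2
    · ring
    · linear_combination (-(σ / 2 + u : ℂ) ^ 2) * I_sq

theorem mellin_gaussian_twist {H : ℝ → ℂ} {σ : ℝ} (hH : MellinConvergent H σ) (w : ℝ) :
    MellinConvergent (fun t => H t * cexp (-(Real.log t : ℂ) ^ 2)) (w * I) ∧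
      (4 * π : ℂ) ^ (1 / 2 : ℂ) * cexp (w ^ 2 / 4) *
          mellin (fun t => H t * cexp (-(Real.log t : ℂ) ^ 2)) (w * I) =
        ∫ v : ℝ, mellin H (σ + v * I) *
          cexp ((σ + v * I) ^ 2 / 4 - (σ + v * I) * (w * I) / 2) := by
  have hpow : ∀ t : ℝ, 0 < t → ∀ z : ℂ, (t : ℂ) ^ z = cexp (Real.log t * z) := fun t ht z => by
    rw [cpow_def_of_ne_zero (ofReal_ne_zero.mpr ht.ne'), ofReal_log ht.le]
  constructor
  · have hb : IntegrableOn (fun t : ℝ => ((t : ℂ) ^ ((σ : ℂ) - 1) • H t) *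
        cexp (-σ * Real.log t - (Real.log t : ℂ) ^ 2 + w * I * Real.log t)) (Set.Ioi 0) := by
      refine Integrable.mul_bdd (c := Real.exp (σ ^ 2 / 4)) hH
        (by fun_prop : Measurable _).aestronglyMeasurable (.of_forall fun t => ?_)
      rw [Complex.norm_exp, Real.exp_le_exp]
      simp [← ofReal_pow]
      nlinarith [sq_nonneg (σ / 2 + Real.log t)]
    refine hb.congr_fun (fun t ht => ?_) measurableSet_Ioi
    simp only [smul_eq_mul, hpow t ht]
    rw [mul_right_comm, ← Complex.exp_add, mul_left_comm, mul_comm (H t), ← Complex.exp_add]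
    ring_nf
  · set E : ℝ → ℂ := fun v => cexp ((σ + v * I) ^ 2 / 4 - (σ + v * I) * (w * I) / 2) with hE
    let f : ℝ → ℝ → ℂ := fun v t =>
      E v * ((t : ℂ) ^ ((σ : ℂ) - 1) • H t) * cexp ((v * Real.log t : ℝ) * I)
    have hf : Integrable (Function.uncurry f) (volume.prod (volume.restrict (Set.Ioi 0))) := by
      refine Integrable.mul_bdd (c := 1) ((integrable_gaussian_twist σ w).mul_prod hH)
        (by fun_prop : Measurable fun p : ℝ × ℝ =>
          cexp ((p.1 * Real.log p.2 : ℝ) * I)).aestronglyMeasurable (.of_forall fun p => ?_)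
      rw [norm_exp_ofReal_mul_I]
    have hswap := integral_integral_swap hf
    have hleft : ∀ v : ℝ, ∫ t in Set.Ioi (0 : ℝ), f v t = mellin H (σ + v * I) * E v := by
      intro v
      rw [mellin, ← integral_mul_const]
      refine setIntegral_congr_fun measurableSet_Ioi fun t ht => ?_
      simp only [f, smul_eq_mul, hpow t ht]
      rw [mul_assoc, mul_right_comm, ← Complex.exp_add, mul_comm]
      push_cast
      ring_nf
    have hright : ∀ t ∈ Set.Ioi (0 : ℝ), ∫ v : ℝ, f v t =
        (4 * π : ℂ) ^ (1 / 2 : ℂ) * cexp (w ^ 2 / 4) *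
          ((t : ℂ) ^ ((w : ℂ) * I - 1) • (H t * cexp (-(Real.log t : ℂ) ^ 2))) := by
      intro t ht
      have h1 : ∀ v : ℝ, f v t = ((t : ℂ) ^ ((σ : ℂ) - 1) • H t) *
          (E v * cexp (v * (Real.log t : ℝ) * I)) := fun v => by
        simp only [f]; push_cast; ring
      simp only [h1, integral_const_mul]
      rw [hE, integral_gaussian_twist]
      simp only [smul_eq_mul, hpow t ht]
      have : ∀ a b c d x y z: ℂ, a + b = c + d + x → cexp a * y * (z * cexp b) =
          z * cexp c * (cexp d * (y * cexp x)) := fun a b c d x y z h => by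
        have h' := congrArg cexp h
        simp only [Complex.exp_add] at h'
        linear_combination y * z * h'
      apply this
      ring
    simp only [hleft] at hswap
    rw [hswap, setIntegral_congr_fun measurableSet_Ioi hright, integral_const_mul, mellin]

/-- Two Mellin transforms, on different vertical lines, that are restrictions of one entire
function bounded in vertical strips come from the same function. -/
theorem eq_of_mellin_eq_entire {F : ℂ → ℂ} (hF : Differentiable ℂ F)
    (hbd : ∀ a b : ℝ, ∃ M : ℝ, ∀ s : ℂ, a ≤ s.re → s.re ≤ b → ‖F s‖ ≤ M)
    {H₁ H₂ D : ℝ → ℂ} {a b : ℝ} (hab : a ≤ b)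
    (h₁ : ∀ v : ℝ, HasMellin H₁ (b + v * I) (F (b + v * I)))
    (h₂ : ∀ v : ℝ, HasMellin H₂ (a + v * I) (F (a + v * I)))
    (hD : ∀ t : ℝ, 0 < t → t ≠ 1 → D t = H₁ t - H₂ t)
    (hDc : ContinuousOn D (Set.Ioi 0)) {t : ℝ} (ht : 0 < t) : D t = 0 := by
  have key : ∀ w : ℝ,
      mellin (fun t => H₁ t * cexp (-(Real.log t : ℂ) ^ 2)) (w * I) =
        mellin (fun t => H₂ t * cexp (-(Real.log t : ℂ) ^ 2)) (w * I) := by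
    intro w
    have e₁ := (mellin_gaussian_twist (by simpa using (h₁ 0).1) w).2
    have e₂ := (mellin_gaussian_twist (by simpa using (h₂ 0).1) w).2
    simp only [(h₁ _).2] at e₁
    simp only [(h₂ _).2] at e₂
    obtain ⟨M, hM⟩ := hbd a b
    have hM0 : 0 ≤ M := (norm_nonneg _).trans (hM a (by simp) (by simpa using hab))
    let B : ℝ → ℝ := fun v => M * Real.exp ((a ^ 2 + b ^ 2) / 4) *
      Real.exp (-(1 / 8) * v ^ 2) * Real.exp (w ^ 2 / 2)
    have hg : Tendsto (fun v : ℝ => Real.exp (-(1 / 8) * v ^ 2)) (cocompact ℝ) (nhds 0) := by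
      simpa using tendsto_rpow_abs_mul_exp_neg_mul_sq_cocompact (a := 1 / 8) (by norm_num) 0
    have hB : Tendsto B (cocompact ℝ) (nhds 0) := by
      simpa [B] using (hg.const_mul _).mul_const _
    have hshift := integral_vertical_line_eq
      (J := fun s => F s * cexp (s ^ 2 / 4 - s * (w * I) / 2)) (by fun_prop) hab (B := B)
      (((integrable_exp_neg_mul_sq (by norm_num)).const_mul _).mul_const _)
      (hB.mono_left atTop_le_cocompact) (hB.mono_left atBot_le_cocompact) (by
        intro x hx v
        rw [norm_mul, Complex.norm_exp]
        simp only [B]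
        rw [mul_assoc, mul_assoc, ← Real.exp_add, ← Real.exp_add]
        refine mul_le_mul (hM _ (by simpa using hx.1) (by simpa using hx.2)) ?_
          (Real.exp_nonneg _) hM0
        rw [Real.exp_le_exp]
        have hx2 : x ^ 2 ≤ a ^ 2 + b ^ 2 := by
          rcases le_total 0 x with h | h
          · nlinarith [hx.2, sq_nonneg a]
          · nlinarith [hx.1, sq_nonneg b]
        have : (((x : ℂ) + v * I) ^ 2 / 4 - (x + v * I) * (w * I) / 2).re =
            (x ^ 2 - v ^ 2) / 4 + v * w / 2 := by
          simp [pow_two]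
          ring
        rw [this]
        nlinarith [sq_nonneg (v / 2 - w)])
    rw [hshift, ← e₁] at e₂
    have hK : (4 * π : ℂ) ^ (1 / 2 : ℂ) * cexp (w ^ 2 / 4) ≠ 0 := by
      refine mul_ne_zero ?_ (Complex.exp_ne_zero _)
      rw [Ne, cpow_eq_zero_iff]
      simp [Real.pi_ne_zero]
    exact (mul_left_cancel₀ hK e₂).symm
  let D' : ℝ → ℂ := fun t => D t * cexp (-(Real.log t : ℂ) ^ 2)
  have hDae : ∀ᵐ x : ℝ ∂volume.restrict (Set.Ioi 0), D x = H₁ x - H₂ x := by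
    filter_upwards [ae_restrict_mem measurableSet_Ioi,
      ae_restrict_of_ae (measure_eq_zero_iff_ae_notMem.mp (measure_singleton (1 : ℝ)))] with x hx hx1
    exact hD x hx hx1
  have hmel : ∀ w : ℝ, HasMellin D' (w * I) 0 := by
    intro w
    have hs := hasMellin_sub (mellin_gaussian_twist (by simpa using (h₁ 0).1) w).1
      (mellin_gaussian_twist (by simpa using (h₂ 0).1) w).1
    rw [key w, sub_self] at hs
    have hc : (fun x : ℝ => (x : ℂ) ^ (w * I - 1 : ℂ) • (H₁ x * cexp (-(Real.log x : ℂ) ^ 2) -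
        H₂ x * cexp (-(Real.log x : ℂ) ^ 2))) =ᵐ[volume.restrict (Set.Ioi 0)]
        fun x : ℝ => (x : ℂ) ^ (w * I - 1 : ℂ) • D' x := by
      filter_upwards [hDae] with x hx
      simp only [D', hx, sub_mul]
    exact ⟨hs.1.congr hc, (integral_congr_ae hc).symm.trans hs.2⟩
  have hzero : ∀ y : ℝ, mellin D' ((0 : ℝ) + y * I) = 0 := fun y => by
    simpa using (hmel y).2
  have hinv := mellinInv_mellin_eq 0 D' ht (by simpa using (hmel 0).1)
    (by simp only [VerticalIntegrable, hzero]; exact integrable_zero _ _ _) (by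
      refine (hDc.continuousAt (Ioi_mem_nhds ht)).mul ?_
      have := Real.continuousAt_log ht.ne'
      fun_prop)
  have : D' t = 0 := by
    rw [← hinv, mellinInv]
    simp only [hzero]
    simp
  exact (mul_eq_zero.mp this).resolve_right (Complex.exp_ne_zero _)

theorem exp_neg_le_rpow {b x : ℝ} (hb : 0 < b) (hx : 0 < x) :
    Real.exp (-x) ≤ b ^ b * x ^ (-b) := by
  rw [Real.rpow_def_of_pos hb, Real.rpow_def_of_pos hx, ← Real.exp_add, Real.exp_le_exp]
  have h := Real.log_le_sub_one_of_pos (div_pos hx hb)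
  rw [Real.log_div hx.ne' hb.ne'] at h
  have h2 := mul_le_mul_of_nonneg_left h hb.le
  have h3 : b * (x / b - 1) = x - b := by field_simp
  nlinarith

/-- Continuous on `(0, ∞)`, and `O(y ^ (-b))` there for every `b > B`. -/
def HasPowerDecay (h : ℝ → ℂ) (B : ℝ) : Prop :=
  ContinuousOn h (Set.Ioi 0) ∧
    ∀ b : ℝ, B < b → ∃ K : ℝ, ∀ y : ℝ, 0 < y → ‖h y‖ ≤ K * y ^ (-b)

namespace HasPowerDecay

variable {h : ℝ → ℂ} {B : ℝ}

theorem isBigO (hh : HasPowerDecay h B) {b : ℝ} (hb : B < b) {l : Filter ℝ}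
    (hl : ∀ᶠ y in l, 0 < y) : h =O[l] (fun y => y ^ (-b)) := by
  obtain ⟨K, hK⟩ := hh.2 b hb
  refine Asymptotics.IsBigO.of_bound K (hl.mono fun y hy => ?_)
  rw [Real.norm_of_nonneg (Real.rpow_nonneg hy.le _)]
  exact hK y hy

theorem mellinConvergent (hh : HasPowerDecay h B) {s : ℂ} (hs : B < s.re) :
    MellinConvergent h s := by
  obtain ⟨b, hb, hbs⟩ := exists_between hs
  exact mellinConvergent_of_isBigO_rpow (hh.1.locallyIntegrableOn measurableSet_Ioi)
    (hh.isBigO (hs.trans (lt_add_one _)) (eventually_gt_atTop 0)) (lt_add_one _)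
    (hh.isBigO hb eventually_mem_nhdsWithin) hbs

theorem tail_locallyIntegrableOn (hh : HasPowerDecay h B) :
    LocallyIntegrableOn ((Set.Ioi 1).indicator h) (Set.Ioi 0) := fun x hx => by
  obtain ⟨t, ht, hi⟩ := hh.1.locallyIntegrableOn (μ := volume) measurableSet_Ioi x hx
  exact ⟨t, ht, hi.indicator measurableSet_Ioi⟩

theorem tail_isBigO_top (hh : HasPowerDecay h B) (r : ℝ) :
    ((Set.Ioi 1).indicator h) =O[atTop] (fun y : ℝ => y ^ (-r)) := by
  have h1 := hh.isBigO (lt_max_of_lt_right (lt_add_one B) : B < max r (B + 1))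
    (eventually_gt_atTop 0)
  refine (h1.congr' ?_ .rfl).trans ?_
  · filter_upwards [eventually_gt_atTop 1] with y hy
    exact (Set.indicator_of_mem (Set.mem_Ioi.mpr hy) h).symm
  · refine Asymptotics.IsBigO.of_bound 1 ?_
    filter_upwards [eventually_ge_atTop 1] with y hy
    have hy0 : 0 ≤ y := zero_le_one.trans hy
    rw [one_mul, Real.norm_of_nonneg (Real.rpow_nonneg hy0 _),
      Real.norm_of_nonneg (Real.rpow_nonneg hy0 _)]
    exact Real.rpow_le_rpow_of_exponent_le hy (neg_le_neg (le_max_left _ _))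

theorem tail_isBigO_zero (r : ℝ) :
    ((Set.Ioi 1).indicator h) =O[nhdsWithin 0 (Set.Ioi 0)] (fun y : ℝ => y ^ (-r)) := by
  refine (Asymptotics.isBigO_zero _ _).congr' ?_ .rfl
  filter_upwards [mem_nhdsWithin_of_mem_nhds (Iio_mem_nhds (zero_lt_one' ℝ))] with y hy
  rw [Set.indicator_of_notMem]
  exact fun h' => lt_asymm (Set.mem_Ioi.mp h') hy

theorem tail_mellinConvergent (hh : HasPowerDecay h B) (s : ℂ) :
    MellinConvergent ((Set.Ioi 1).indicator h) s :=
  mellinConvergent_of_isBigO_rpow hh.tail_locallyIntegrableOn (hh.tail_isBigO_top _)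
    (lt_add_one _) (tail_isBigO_zero _) (sub_one_lt _)

theorem tail_differentiable (hh : HasPowerDecay h B) :
    Differentiable ℂ (mellin ((Set.Ioi 1).indicator h)) := fun _ =>
  mellin_differentiableAt_of_isBigO_rpow hh.tail_locallyIntegrableOn (hh.tail_isBigO_top _)
    (lt_add_one _) (tail_isBigO_zero _) (sub_one_lt _)

theorem tail_bounded (hh : HasPowerDecay h B) (b : ℝ) :
    ∃ M : ℝ, ∀ s : ℂ, s.re ≤ b → ‖mellin ((Set.Ioi 1).indicator h) s‖ ≤ M := by
  refine ⟨∫ t in Set.Ioi (0 : ℝ), ‖(t : ℂ) ^ ((b : ℂ) - 1) • (Set.Ioi 1).indicator h t‖,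
    fun _ hs => ?_⟩
  refine norm_integral_le_of_norm_le (hh.tail_mellinConvergent b).norm ?_
  filter_upwards [ae_restrict_mem measurableSet_Ioi] with t ht
  by_cases h1 : t ∈ Set.Ioi 1
  · rw [norm_smul, norm_smul, norm_cpow_eq_rpow_re_of_pos ht, norm_cpow_eq_rpow_re_of_pos ht]
    refine mul_le_mul_of_nonneg_right
      (Real.rpow_le_rpow_of_exponent_le (le_of_lt h1) ?_) (norm_nonneg _)
    simpa using hs
  · simp [Set.indicator_of_notMem h1]

end HasPowerDecay

theorem HasMellin.const_mul_cpow_mul_comp_inv {g : ℝ → ℂ} {s k m : ℂ}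
    (hg : HasMellin g (k - s) m) (γ : ℂ) :
    HasMellin (fun t : ℝ => γ * ((t : ℂ) ^ (-k) * g t⁻¹)) s (γ * m) := by
  have h1 : MellinConvergent (fun t : ℝ => (t : ℂ) ^ (-k) • g t⁻¹) s := by
    rw [MellinConvergent.cpow_smul]
    have := (MellinConvergent.comp_rpow (f := g) (s := s + -k) (a := -1) (by norm_num)).mpr
      (by convert hg.1 using 1; push_cast; ring)
    simpa only [Real.rpow_neg_one] using this
  have h2 : mellin (fun t : ℝ => (t : ℂ) ^ (-k) • g t⁻¹) s = m := by
    rw [mellin_cpow_smul, mellin_comp_inv, ← hg.2]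
    congr 1
    ring
  have h3 := hasMellin_const_smul h1 γ
  rw [h2] at h3
  exact h3

theorem hasMellin_add_poles {h : ℝ → ℂ} {s : ℂ} (hh : MellinConvergent h s) (a b : ℂ) {k : ℝ}
    (hs : 0 < s.re) (hks : k < s.re) :
    HasMellin (fun t => h t + (a * (Set.Ioc 0 1).indicator (fun _ => (1 : ℂ)) t -
        b * (Set.Ioc 0 1).indicator (fun t : ℝ => (t : ℂ) ^ (-k : ℂ)) t)) s
      (mellin h s + a / s + b / (k - s)) := by
  have h1 := hasMellin_one_Ioc hs
  have h2 := hasMellin_cpow_Ioc (-k : ℂ) (s := s) (by simpa using hks)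
  have h1' := hasMellin_const_smul h1.1 a
  have h2' := hasMellin_const_smul h2.1 b
  have h3 := hasMellin_sub h1'.1 h2'.1
  have h4 := hasMellin_add hh h3.1
  rw [h3.2, h1'.2, h2'.2, h1.2, h2.2] at h4
  have h5 : mellin h s + a / s + b / (k - s) =
      mellin h s + (a • (1 / s) - b • (1 / (s + -k))) := by
    rw [← neg_sub s, div_neg, smul_eq_mul, smul_eq_mul, ← sub_eq_add_neg]
    ring
  rw [h5]
  exact h4

theorem tail_add_tail_eq {h g : ℝ → ℂ} {B k : ℝ} {a b γ : ℂ} (hB : 0 ≤ B)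
    (hh : HasPowerDecay h B) (hg : HasPowerDecay g B)
    (hrel : ∀ t : ℝ, 0 < t → a + h t = γ * ((t : ℂ) ^ (-k : ℂ) * (b + g t⁻¹)))
    {s : ℂ} (hs : B < s.re) :
    mellin ((Set.Ioi 1).indicator h) s + γ * mellin ((Set.Ioi 1).indicator g) (k - s) =
      mellin h s + a / s + γ * b / (k - s) := by
  have hT := hh.tail_mellinConvergent s
  have hU := HasMellin.const_mul_cpow_mul_comp_inv (s := s) (k := k)
    ⟨hg.tail_mellinConvergent _, rfl⟩ γ
  have hV := hasMellin_one_Ioc (hB.trans_lt hs)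
  have hV' := hasMellin_const_smul hV.1 a
  have h1 := hasMellin_add hT hU.1
  have h2 := hasMellin_add (hh.mellinConvergent hs) hV'.1
  have h3 := hasMellin_sub h2.1 h1.1
  rw [h2.2, hV'.2, hV.2, h1.2, hU.2] at h3
  have hcongr : (fun t : ℝ => (t : ℂ) ^ (s - 1) • (Set.Ioc 0 1).indicator
      (fun t : ℝ => γ * b * (t : ℂ) ^ (-k : ℂ)) t) =ᵐ[volume.restrict (Set.Ioi 0)] fun t : ℝ =>
      (t : ℂ) ^ (s - 1) • ((h t + a • (Set.Ioc 0 1).indicator (fun _ => (1 : ℂ)) t) -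
        ((Set.Ioi 1).indicator h t +
          γ * ((t : ℂ) ^ (-k : ℂ) * (Set.Ioi 1).indicator g t⁻¹))) := by
    filter_upwards [ae_restrict_mem measurableSet_Ioi,
      ae_restrict_of_ae (measure_eq_zero_iff_ae_notMem.mp (measure_singleton (1 : ℝ)))]
      with t ht ht1
    have ht0 : 0 < t := ht
    congr 1
    rcases lt_or_gt_of_ne (show t ≠ 1 from ht1) with hlt | hgt
    · have e1 : t ∈ Set.Ioc (0 : ℝ) 1 := ⟨ht0, hlt.le⟩
      have e2 : t ∉ Set.Ioi (1 : ℝ) := fun h' => lt_asymm h' hlt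
      have e3 : t⁻¹ ∈ Set.Ioi (1 : ℝ) := (one_lt_inv₀ ht0).mpr hlt
      simp only [Set.indicator_of_mem e1, Set.indicator_of_notMem e2, Set.indicator_of_mem e3,
        smul_eq_mul]
      linear_combination -hrel t ht0
    · have e1 : t ∉ Set.Ioc (0 : ℝ) 1 := fun h' => not_lt.mpr h'.2 hgt
      have e2 : t ∈ Set.Ioi (1 : ℝ) := hgt
      have e3 : t⁻¹ ∉ Set.Ioi (1 : ℝ) := fun h' => lt_asymm hgt ((one_lt_inv₀ ht0).mp h')
      simp [Set.indicator_of_notMem e1, Set.indicator_of_mem e2, Set.indicator_of_notMem e3]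
  have h4 : HasMellin ((Set.Ioc 0 1).indicator (fun t : ℝ => γ * b * (t : ℂ) ^ (-k : ℂ))) s _ :=
    ⟨h3.1.congr hcongr.symm, (integral_congr_ae hcongr).trans h3.2⟩
  suffices hm : mellin ((Set.Ioc 0 1).indicator (fun t : ℝ => γ * b * (t : ℂ) ^ (-k : ℂ))) s =
      - (γ * b / (k - s)) by
    rw [h4.2, smul_eq_mul] at hm
    linear_combination -hm
  by_cases hb : γ * b = 0
  · simp [hb, mellin]
  have hks : k < s.re := by
    have h5 : IntegrableOn (fun t : ℝ => (t : ℂ) ^ (s - 1 - k)) (Set.Ioo 0 1) := by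
      have h6 : IntegrableOn _ (Set.Ioo (0 : ℝ) 1) := (h4.1.mono_set Set.Ioo_subset_Ioi_self)
      refine IntegrableOn.congr_fun (h6.const_mul (γ * b)⁻¹) (fun t ht => ?_) measurableSet_Ioo
      have ht0 : (t : ℂ) ≠ 0 := ofReal_ne_zero.mpr ht.1.ne'
      have e1 : t ∈ Set.Ioc (0 : ℝ) 1 := ⟨ht.1, ht.2.le⟩
      simp only [Set.indicator_of_mem e1, smul_eq_mul]
      rw [sub_eq_add_neg (s - 1), cpow_add _ _ ht0, mul_left_comm,
        inv_mul_cancel_left₀ hb]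
    rw [intervalIntegral.integrableOn_Ioo_cpow_iff zero_lt_one] at h5
    simpa using h5
  have h7 := hasMellin_cpow_Ioc (-k : ℂ) (s := s) (by simpa using hks)
  have h8 := (hasMellin_const_smul h7.1 (γ * b)).2
  rw [h7.2] at h8
  rw [← neg_sub s, div_neg, neg_neg, sub_eq_add_neg, div_eq_mul_one_div,
    ← smul_eq_mul (γ * b), ← h8]
  congr 1
  ext t
  by_cases e : t ∈ Set.Ioc (0 : ℝ) 1 <;> simp [e]

/-- The `q`-expansion `∑_{n ≥ 0} α_n e^{2πinτ/λ}`. -/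
noncomputable def qSeries (lam : ℝ) (α : ℕ → ℂ) (τ : ℂ) : ℂ :=
  ∑' n : ℕ, α n * Complex.exp (2 * π * Complex.I * n * τ / lam)

/-- The exponential sum `∑_{n ≥ 1} α_n e^{-2πny/λ}`. -/
noncomputable def expSum (lam : ℝ) (α : ℕ → ℂ) (y : ℝ) : ℂ :=
  ∑' n : ℕ, α (n + 1) * (Real.exp (-(2 * π / lam * (n + 1)) * y) : ℂ)

section Coefficients

variable {lam c : ℝ} {α : ℕ → ℂ}

theorem norm_coeff_mul_exp_le (hlam : 0 < lam) {C : ℝ}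
    (hα : ∀ n : ℕ, 1 ≤ n → ‖α n‖ ≤ C * (n : ℝ) ^ c) {b : ℝ} (hb : 0 < b) {y : ℝ} (hy : 0 < y)
    (n : ℕ) :
    ‖α (n + 1)‖ * Real.exp (-(2 * π / lam * (n + 1)) * y) ≤
      C * (b ^ b * (2 * π / lam) ^ (-b)) * ((n + 1 : ℕ) : ℝ) ^ (c - b) * y ^ (-b) := by
  have hn : (0 : ℝ) < (n + 1 : ℕ) := by positivity
  have hp : 0 < 2 * π / lam := by positivity
  have h1 := hα (n + 1) (by omega)
  have h2 := exp_neg_le_rpow hb (show 0 < 2 * π / lam * (n + 1 : ℕ) * y by positivity)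
  rw [Real.mul_rpow (by positivity) hy.le, Real.mul_rpow hp.le hn.le] at h2
  have h3 := mul_le_mul h1 h2 (Real.exp_nonneg _) ((norm_nonneg _).trans h1)
  rw [sub_eq_add_neg, Real.rpow_add hn]
  refine (le_of_eq ?_).trans (h3.trans (le_of_eq ?_))
  · push_cast; ring_nf
  · ring

theorem summable_rpow_sub {b : ℝ} (hb : c + 1 < b) :
    Summable fun n : ℕ => ((n + 1 : ℕ) : ℝ) ^ (c - b) :=
  (summable_nat_add_iff 1).mpr (Real.summable_nat_rpow.mpr (by linarith))

theorem summable_norm_coeff_mul_exp (hlam : 0 < lam) (hc : 0 ≤ c)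
    (hα : ∃ C : ℝ, ∀ n : ℕ, 1 ≤ n → ‖α n‖ ≤ C * (n : ℝ) ^ c) {y : ℝ} (hy : 0 < y) :
    Summable fun n : ℕ => ‖α (n + 1)‖ * Real.exp (-(2 * π / lam * (n + 1)) * y) := by
  obtain ⟨C, hC⟩ := hα
  exact .of_nonneg_of_le (fun n => by positivity)
    (norm_coeff_mul_exp_le hlam hC (b := c + 2) (by linarith) hy)
    (((summable_rpow_sub (by linarith)).mul_left _).mul_right _)

theorem norm_qSeries_term (n : ℕ) (τ : ℂ) :
    ‖α n * Complex.exp (2 * π * Complex.I * n * τ / lam)‖ =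
      ‖α n‖ * Real.exp (-(2 * π / lam * n) * τ.im) := by
  rw [norm_mul, Complex.norm_exp]
  congr 2
  rw [show 2 * (π : ℂ) * I * n * τ / lam = ((2 * π / lam * n : ℝ) : ℂ) * (I * τ) by
    push_cast; ring, re_ofReal_mul]
  simp

theorem summable_norm_qSeries (hlam : 0 < lam) (hc : 0 ≤ c)
    (hα : ∃ C : ℝ, ∀ n : ℕ, 1 ≤ n → ‖α n‖ ≤ C * (n : ℝ) ^ c) {y : ℝ} (hy : 0 < y) :
    Summable fun n : ℕ => ‖α n‖ * Real.exp (-(2 * π / lam * n) * y) := by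
  rw [← summable_nat_add_iff 1]
  exact_mod_cast summable_norm_coeff_mul_exp hlam hc hα hy

theorem differentiableAt_qSeries (hlam : 0 < lam) (hc : 0 ≤ c)
    (hα : ∃ C : ℝ, ∀ n : ℕ, 1 ≤ n → ‖α n‖ ≤ C * (n : ℝ) ^ c) {τ : ℂ} (hτ : 0 < τ.im) :
    DifferentiableAt ℂ (qSeries lam α) τ := by
  obtain ⟨δ, hδ, hδτ⟩ := exists_between hτ
  have hopen : IsOpen {z : ℂ | δ < z.im} := isOpen_lt continuous_const continuous_im
  refine (differentiableOn_tsum_of_summable_norm (summable_norm_qSeries hlam hc hα hδ)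
    (fun n => by fun_prop) hopen fun n z hz => ?_).differentiableAt (hopen.mem_nhds hδτ)
  rw [norm_qSeries_term]
  have hz' : δ < z.im := hz
  refine mul_le_mul_of_nonneg_left (Real.exp_le_exp.mpr ?_) (norm_nonneg _)
  exact mul_le_mul_of_nonpos_left hz'.le (neg_nonpos.mpr (by positivity))

theorem qSeries_I_mul (hlam : 0 < lam) (hc : 0 ≤ c)
    (hα : ∃ C : ℝ, ∀ n : ℕ, 1 ≤ n → ‖α n‖ ≤ C * (n : ℝ) ^ c) {y : ℝ} (hy : 0 < y) :
    qSeries lam α (I * y) = α 0 + expSum lam α y := by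
  have hs : Summable fun n : ℕ => α n * Complex.exp (2 * π * Complex.I * n * (I * y) / lam) := by
    refine Summable.of_norm ?_
    simp only [norm_qSeries_term]
    simpa using summable_norm_qSeries hlam hc hα hy
  rw [qSeries, hs.tsum_eq_zero_add, expSum]
  congr 1
  · simp
  · refine tsum_congr fun n => ?_
    congr 1
    push_cast
    congr 1
    linear_combination (2 * π * (n + 1) * y / lam : ℂ) * I_sq

theorem hasPowerDecay_expSum (hlam : 0 < lam) (hc : 0 ≤ c)
    (hα : ∃ C : ℝ, ∀ n : ℕ, 1 ≤ n → ‖α n‖ ≤ C * (n : ℝ) ^ c) :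
    HasPowerDecay (expSum lam α) (c + 1) := by
  refine ⟨fun y hy => ContinuousAt.continuousWithinAt ?_, fun b hb => ?_⟩
  · have hy0 : 0 < y := hy
    have h1 : ContinuousAt (fun t : ℝ => qSeries lam α (I * t) - α 0) y := by
      have h2 : ContinuousAt (qSeries lam α) (I * y) :=
        (differentiableAt_qSeries hlam hc hα (by simpa using hy0)).continuousAt
      have h3 : ContinuousAt (fun t : ℝ => I * (t : ℂ)) y := by fun_prop
      exact (ContinuousAt.comp (f := fun t : ℝ => I * (t : ℂ)) h2 h3).sub continuousAt_const
    refine h1.congr ?_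
    filter_upwards [Ioi_mem_nhds hy0] with t ht
    rw [qSeries_I_mul hlam hc hα ht, add_sub_cancel_left]
  · obtain ⟨C, hC⟩ := hα
    refine ⟨∑' n : ℕ, C * (b ^ b * (2 * π / lam) ^ (-b)) * ((n + 1 : ℕ) : ℝ) ^ (c - b),
      fun y hy => ?_⟩
    have hs := (summable_rpow_sub hb).mul_left (C * (b ^ b * (2 * π / lam) ^ (-b)))
    refine tsum_of_norm_bounded (hs.hasSum.mul_right _) fun n => ?_
    rw [norm_mul, norm_real, Real.norm_of_nonneg (Real.exp_nonneg _)]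
    exact norm_coeff_mul_exp_le hlam hC (by linarith) hy n

theorem mellin_expSum (hlam : 0 < lam) (hc : 0 ≤ c)
    (hα : ∃ C : ℝ, ∀ n : ℕ, 1 ≤ n → ‖α n‖ ≤ C * (n : ℝ) ^ c) {s : ℂ} (hs : c + 1 < s.re) :
    mellin (expSum lam α) s = completed lam α s := by
  have hp : 0 < 2 * π / lam := by positivity
  have h := hasSum_mellin (a := fun n : ℕ => α (n + 1)) (p := fun n => 2 * π / lam * (n + 1))
    (F := expSum lam α) (s := s) (fun n => Or.inr (by positivity)) (by linarith)
    (fun t ht => by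
      refine (Summable.of_norm ?_).hasSum
      refine (summable_norm_coeff_mul_exp hlam hc hα ht).congr fun n => ?_
      rw [norm_mul, norm_real, Real.norm_of_nonneg (Real.exp_nonneg _)])
    (by
      obtain ⟨C, hC⟩ := hα
      refine .of_nonneg_of_le (fun n => by positivity) (fun n => ?_)
        ((summable_rpow_sub hs).mul_left (C * (2 * π / lam) ^ (-s.re)))
      have hn : (0 : ℝ) < (n + 1 : ℕ) := by positivity
      have h1 := hC (n + 1) (by omega)
      have hn' : (n : ℝ) + 1 = (n + 1 : ℕ) := by push_cast; rfl
      rw [hn', Real.mul_rpow hp.le hn.le, div_eq_mul_inv, mul_inv, ← Real.rpow_neg hp.le,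
        ← Real.rpow_neg hn.le, sub_eq_add_neg, Real.rpow_add hn]
      refine (mul_le_mul_of_nonneg_right h1 (by positivity)).trans (le_of_eq ?_)
      ring)
  rw [← h.tsum_eq, completed, dseries, ← tsum_mul_left]
  refine tsum_congr fun n => ?_
  rw [ofReal_mul, mul_cpow_ofReal_nonneg hp.le (by positivity), cpow_neg]
  push_cast
  field_simp

end Coefficients

/-- The modular relation holds on the upper half-plane as soon as it holds on the imaginary
axis. -/
theorem modular_relation_of_imaginary_axis {f g : ℂ → ℂ} {k γ : ℂ}
    (hf : ∀ τ : ℂ, 0 < τ.im → DifferentiableAt ℂ f τ)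
    (hg : ∀ τ : ℂ, 0 < τ.im → DifferentiableAt ℂ g τ)
    (h : ∀ y : ℝ, 0 < y → f (I * y) = γ * (y : ℂ) ^ (-k) * g (I * (y⁻¹ : ℝ)))
    {τ : ℂ} (hτ : 0 < τ.im) : f τ = γ * (τ / I) ^ (-k) * g (-1 / τ) := by
  have hopen : IsOpen {z : ℂ | 0 < z.im} := isOpen_lt continuous_const continuous_im
  have him : ∀ z : ℂ, 0 < z.im → 0 < (-1 / z).im := fun z hz => by
    have hz0 : z ≠ 0 := fun h0 => by simp [h0] at hz
    rw [neg_div, one_div, neg_im, inv_im, neg_div, neg_neg]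
    exact div_pos hz (normSq_pos.mpr hz0)
  have hF : AnalyticOnNhd ℂ f {z : ℂ | 0 < z.im} :=
    DifferentiableOn.analyticOnNhd (fun z hz => (hf z hz).differentiableWithinAt) hopen
  have hG : AnalyticOnNhd ℂ (fun z => γ * (z / I) ^ (-k) * g (-1 / z)) {z : ℂ | 0 < z.im} := by
    refine DifferentiableOn.analyticOnNhd (fun z hz => ?_) hopen
    have hz' : 0 < z.im := hz
    have hz0 : z ≠ 0 := fun h0 => by simp [h0] at hz'
    have h1 : DifferentiableAt ℂ (fun z : ℂ => (z / I) ^ (-k)) z :=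
      DifferentiableAt.cpow_const (by fun_prop) (by left; simpa [div_I] using hz')
    have h2 : DifferentiableAt ℂ (fun z : ℂ => g (-1 / z)) z :=
      (hg _ (him z hz)).comp z (by fun_prop (disch := exact hz0))
    exact ((h1.const_mul γ).mul h2).differentiableWithinAt
  have hfreq : ∃ᶠ z in nhdsWithin I {I}ᶜ, f z = γ * (z / I) ^ (-k) * g (-1 / z) := by
    have ht : Tendsto (fun y : ℝ => I * (y : ℂ)) (nhdsWithin 1 {1}ᶜ) (nhdsWithin I {I}ᶜ) := by
      refine tendsto_nhdsWithin_iff.mpr ⟨?_, ?_⟩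
      · have : ContinuousAt (fun y : ℝ => I * (y : ℂ)) 1 := by fun_prop
        simpa using this.tendsto.mono_left nhdsWithin_le_nhds
      · filter_upwards [self_mem_nhdsWithin] with y hy
        simpa using hy
    refine ht.frequently (Eventually.frequently ?_)
    filter_upwards [mem_nhdsWithin_of_mem_nhds (Ioi_mem_nhds (zero_lt_one' ℝ))] with y hy
    have hy0 : (y : ℂ) ≠ 0 := ofReal_ne_zero.mpr (ne_of_gt hy)
    rw [h y hy, mul_div_cancel_left₀ _ I_ne_zero]
    congr 2
    push_cast
    field_simp
    simp
  exact hF.eqOn_of_preconnected_of_frequently_eq hG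
    (convex_halfSpace_im_gt 0).isPreconnected (show (0 : ℝ) < I.im by simp) hfreq hτ

theorem inv_modular_relation {f g : ℝ → ℂ} {k : ℝ} {a b γ : ℂ} (hγ : γ ≠ 0)
    (hrel : ∀ t : ℝ, 0 < t → a + f t = γ * ((t : ℂ) ^ (-k : ℂ) * (b + g t⁻¹)))
    {t : ℝ} (ht : 0 < t) : b + g t = γ⁻¹ * ((t : ℂ) ^ (-k : ℂ) * (a + f t⁻¹)) := by
  have ht0 : (t : ℂ) ≠ 0 := ofReal_ne_zero.mpr ht.ne'
  rw [hrel t⁻¹ (inv_pos.mpr ht), inv_inv, ofReal_inv,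
    inv_cpow _ _ (by rw [arg_ofReal_of_nonneg ht.le]; exact Real.pi_pos.ne), cpow_neg, inv_inv]
  have hk : (t : ℂ) ^ (k : ℂ) ≠ 0 := by simp [cpow_eq_zero_iff, ht0]
  field_simp

/-- If completed Mellin transforms are entire, bounded in vertical strips and satisfy the
functional equation, then the original functions satisfy the modular relation. -/
theorem modular_relation_of_functional_equation {f g : ℝ → ℂ} {B k : ℝ} {a b γ : ℂ}
    (hγ : γ ≠ 0) (hf : HasPowerDecay f B) (hg : HasPowerDecay g B) {F G : ℂ → ℂ}
    (hF : Differentiable ℂ F)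
    (hbd : ∀ a b : ℝ, ∃ M : ℝ, ∀ s : ℂ, a ≤ s.re → s.re ≤ b → ‖F s‖ ≤ M)
    (hFf : ∀ s : ℂ, B < s.re → F s = mellin f s + a / s + γ * b / (k - s))
    (hGg : ∀ s : ℂ, B < s.re → G s = mellin g s + b / s + γ⁻¹ * a / (k - s))
    (hFG : ∀ s : ℂ, F s = γ * G (k - s)) {t : ℝ} (ht : 0 < t) :
    a + f t = γ * ((t : ℂ) ^ (-k : ℂ) * (b + g t⁻¹)) := by
  obtain ⟨σ, hσ⟩ := exists_gt (max B (max k 0))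
  obtain ⟨hσB, hσ'⟩ := max_lt_iff.mp hσ
  obtain ⟨hσk, hσ0⟩ := max_lt_iff.mp hσ'
  have h₁ : ∀ s : ℂ, s.re = σ → HasMellin _ s (F s) := fun s hs => by
    have hs' : B < s.re := by rwa [hs]
    rw [hFf s hs']
    exact hasMellin_add_poles (hf.mellinConvergent hs') a (γ * b) (k := k) (by rwa [hs])
      (by rwa [hs])
  have h₂ : ∀ s : ℂ, s.re = σ → HasMellin _ s (G s) := fun s hs => by
    have hs' : B < s.re := by rwa [hs]
    rw [hGg s hs']
    exact hasMellin_add_poles (hg.mellinConvergent hs') b (γ⁻¹ * a) (k := k) (by rwa [hs])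
      (by rwa [hs])
  have h₃ : ∀ v : ℝ, HasMellin _ (((k - σ : ℝ) : ℂ) + v * I) (F (((k - σ : ℝ) : ℂ) + v * I)) :=
    fun v => by
      rw [hFG]
      exact (h₂ (k - (((k - σ : ℝ) : ℂ) + v * I)) (by simp)).const_mul_cpow_mul_comp_inv γ
  have hcont : ContinuousOn
      (fun t : ℝ => a + f t - γ * ((t : ℂ) ^ (-k : ℂ) * (b + g t⁻¹))) (Set.Ioi 0) := by
    have h4 : ContinuousOn (fun t : ℝ => (t : ℂ) ^ (-k : ℂ)) (Set.Ioi 0) := fun t ht =>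
      (continuousAt_ofReal_cpow_const _ _ (Or.inr (ne_of_gt ht))).continuousWithinAt
    have h5 : ContinuousOn (fun t : ℝ => g t⁻¹) (Set.Ioi 0) :=
      hg.1.comp (continuousOn_inv₀.mono fun t ht => ne_of_gt ht) 
        fun t (ht : 0 < t) => Set.mem_Ioi.mpr (inv_pos.mpr ht)
    exact (continuousOn_const.add hf.1).sub
      (continuousOn_const.mul (h4.mul (continuousOn_const.add h5)))
  refine sub_eq_zero.mp (eq_of_mellin_eq_entire hF hbd (a := k - σ) (b := σ) (by linarith)
    (fun v => h₁ _ (by simp)) h₃ (fun t ht ht1 => ?_) hcont ht)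
  have ht0 : (t : ℂ) ≠ 0 := ofReal_ne_zero.mpr ht.ne'
  rcases lt_or_gt_of_ne ht1 with hlt | hgt
  · have e1 : t ∈ Set.Ioc (0 : ℝ) 1 := ⟨ht, hlt.le⟩
    have e2 : t⁻¹ ∉ Set.Ioc (0 : ℝ) 1 := fun h' => not_lt.mpr h'.2 ((one_lt_inv₀ ht).mpr hlt)
    simp only [Set.indicator_of_mem e1, Set.indicator_of_notMem e2]
    ring
  · have e1 : t ∉ Set.Ioc (0 : ℝ) 1 := fun h' => not_lt.mpr h'.2 hgt
    have e2 : t⁻¹ ∈ Set.Ioc (0 : ℝ) 1 := ⟨inv_pos.mpr ht, (inv_le_one₀ ht).mpr hgt.le⟩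
    have e3 : (t : ℂ) ^ (-k : ℂ) * ((t⁻¹ : ℝ) : ℂ) ^ (-k : ℂ) = 1 := by
      rw [ofReal_inv, inv_cpow _ _ (by rw [arg_ofReal_of_nonneg ht.le]; exact Real.pi_pos.ne),
        mul_inv_cancel₀]
      simp [cpow_eq_zero_iff, ht0]
    simp only [Set.indicator_of_notMem e1, Set.indicator_of_mem e2]
    linear_combination (-γ * γ⁻¹ * a) * e3 - a * mul_inv_cancel₀ hγ

/-- Hecke's correspondence theorem: the modular relation
`f_α(τ) = γ (τ/i)^{-k} f_β(-1/τ)` on the upper half-plane is equivalent to the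
existence of entire continuations `F`, `G` of `Φ(s) + α₀/s + γβ₀/(k-s)` and
`Ψ(s) + β₀/s + α₀/(γ(k-s))` that are bounded in every vertical strip and satisfy
the functional equation `Φ(s) = γ Ψ(k - s)`. -/
theorem hecke_correspondence
    (lam k : ℝ) (γ : ℂ) (c : ℝ) (α β : ℕ → ℂ)
    (hlam : 0 < lam) (hγ : γ ≠ 0) (hc : 0 ≤ c)
    (hα : ∃ C : ℝ, ∀ n : ℕ, 1 ≤ n → ‖α n‖ ≤ C * (n : ℝ) ^ c)
    (hβ : ∃ C : ℝ, ∀ n : ℕ, 1 ≤ n → ‖β n‖ ≤ C * (n : ℝ) ^ c) :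
    (∀ τ : ℂ, 0 < τ.im →
        ∑' n : ℕ, α n * Complex.exp (2 * π * Complex.I * n * τ / lam) =
          γ * (τ / Complex.I) ^ (-(k : ℂ)) *
            ∑' n : ℕ, β n * Complex.exp (2 * π * Complex.I * n * (-1 / τ) / lam))
    ↔
    (∃ F G : ℂ → ℂ,
      Differentiable ℂ F ∧ Differentiable ℂ G ∧
      (∀ a b : ℝ, ∃ M : ℝ, ∀ s : ℂ, a ≤ s.re → s.re ≤ b → ‖F s‖ ≤ M) ∧
      (∀ a b : ℝ, ∃ M : ℝ, ∀ s : ℂ, a ≤ s.re → s.re ≤ b → ‖G s‖ ≤ M) ∧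
      (∀ s : ℂ, c + 1 < s.re →
        F s = completed lam α s + α 0 / s + γ * β 0 / ((k : ℂ) - s)) ∧
      (∀ s : ℂ, c + 1 < s.re →
        G s = completed lam β s + β 0 / s + α 0 / (γ * ((k : ℂ) - s))) ∧
      (∀ s : ℂ, F s = γ * G ((k : ℂ) - s))) := by
  have hdα := hasPowerDecay_expSum hlam hc hα
  have hdβ := hasPowerDecay_expSum hlam hc hβ
  have hα_mellin := fun s => mellin_expSum hlam hc hα (s := s)
  have hβ_mellin := fun s => mellin_expSum hlam hc hβ (s := s)
  constructor
  · intro h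
    have hrel : ∀ t : ℝ, 0 < t → α 0 + expSum lam α t =
        γ * ((t : ℂ) ^ (-k : ℂ) * (β 0 + expSum lam β t⁻¹)) := by
      intro t ht
      have h1 := h (I * t) (by simpa using ht)
      have h2 : -1 / (I * (t : ℂ)) = I * ((t⁻¹ : ℝ) : ℂ) := by
        have ht0 : (t : ℂ) ≠ 0 := ofReal_ne_zero.mpr ht.ne'
        push_cast
        field_simp
        simp
      rw [h2, mul_div_cancel_left₀ _ I_ne_zero] at h1
      rw [← qSeries_I_mul hlam hc hα ht, ← qSeries_I_mul hlam hc hβ (inv_pos.mpr ht), ← mul_assoc]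
      exact h1
    have hrel' := fun t (ht : 0 < t) => inv_modular_relation hγ hrel ht
    have hbounded : ∀ {f g : ℝ → ℂ} (δ : ℂ), HasPowerDecay f (c + 1) → HasPowerDecay g (c + 1) →
        ∀ a b : ℝ, ∃ M : ℝ, ∀ s : ℂ, a ≤ s.re → s.re ≤ b →
          ‖mellin ((Set.Ioi 1).indicator f) s +
            δ * mellin ((Set.Ioi 1).indicator g) (k - s)‖ ≤ M := by
      intro f g δ hf hg a b
      obtain ⟨M, hM⟩ := hf.tail_bounded b
      obtain ⟨N, hN⟩ := hg.tail_bounded (k - a)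
      refine ⟨M + ‖δ‖ * N, fun s ha hb => (norm_add_le _ _).trans (add_le_add (hM s hb) ?_)⟩
      rw [norm_mul]
      exact mul_le_mul_of_nonneg_left (hN _ (by rw [sub_re, ofReal_re]; linarith)) (norm_nonneg _)
    have hentire : ∀ {f g : ℝ → ℂ} (δ : ℂ), HasPowerDecay f (c + 1) → HasPowerDecay g (c + 1) →
        Differentiable ℂ fun s => mellin ((Set.Ioi 1).indicator f) s +
            δ * mellin ((Set.Ioi 1).indicator g) (k - s) := by
      intro f g δ hf hg
      have h1 := hf.tail_differentiable
      have h2 := hg.tail_differentiable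
      fun_prop
    refine ⟨_, _, hentire γ hdα hdβ, hentire γ⁻¹ hdβ hdα, hbounded γ hdα hdβ,
      hbounded γ⁻¹ hdβ hdα, fun s hs => ?_, fun s hs => ?_, fun s => ?_⟩
    · rw [tail_add_tail_eq (by linarith) hdα hdβ hrel hs, hα_mellin s hs]
    · rw [tail_add_tail_eq (by linarith) hdβ hdα hrel' hs, hβ_mellin s hs,
        div_mul_eq_div_div, ← div_eq_inv_mul]
    · rw [sub_sub_cancel, mul_add, mul_inv_cancel_left₀ hγ, add_comm]
  · rintro ⟨F, G, hF, -, hbd, -, hFα, hGβ, hFG⟩ τ hτ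
    have hrel : ∀ t : ℝ, 0 < t → _ := fun t ht =>
      modular_relation_of_functional_equation hγ hdα hdβ hF hbd
        (fun s hs => by rw [hFα s hs, hα_mellin s hs])
        (fun s hs => by rw [hGβ s hs, hβ_mellin s hs, div_mul_eq_div_div, ← div_eq_inv_mul])
        hFG ht
    refine modular_relation_of_imaginary_axis (f := qSeries lam α) (g := qSeries lam β)
      (fun z hz => differentiableAt_qSeries hlam hc hα hz)
      (fun z hz => differentiableAt_qSeries hlam hc hβ hz) (fun y hy => ?_) hτ
    rw [qSeries_I_mul hlam hc hα hy, qSeries_I_mul hlam hc hβ (inv_pos.mpr hy), hrel y hy,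
      mul_assoc]
end

section
/- Let c ≥ 0 and let (α_n)_{n≥1}, (β_n)_{n≥1} be complex sequences with α_n = O(n^c) and β_n = O(n^c). Let a > 0, x > 0, and let u, v ∈ ℂ with Re(u) > c+1+a and Re(v) > c+1+a. Then (1/2πi) ∫_{a−i∞}^{a+i∞} φ(u+w) ψ(v−w) x^{w+1}/(w(w+1)) dw = Σ_{m=1}^∞ (β_m/m^{v+1}) Σ'_{n ≤ mx} (α_n/n^u)(mx − n), where Σ'_{n ≤ mx} denotes the sum over positive integers n ≤ mx in which the term with n = mx (when mx is an integer) is halved. -/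
open Complex Real Filter MeasureTheory

/-- The primed sum `Σ'_{n ≤ x} f(n)`: the sum of `f(n)` over positive integers `n ≤ x`,
where the term `n = x` is halved when `x` is an integer. -/
noncomputable def primedSum (f : ℕ → ℂ) (x : ℝ) : ℂ :=
  ∑ n ∈ Finset.Icc 1 ⌊x⌋₊, (if (n : ℝ) = x then f n / 2 else f n)

/-- The function `w ↦ 1 / (w (w + 1))` is integrable on vertical lines to the right of `0`. -/
lemma integrable_perron_weight {a : ℝ} (ha : 0 < a) :
    Integrable fun t : ℝ ↦
      1 / (((a : ℂ) + t * Complex.I) * (((a : ℂ) + t * Complex.I) + 1)) := by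
  have hre (t : ℝ) : ((a : ℂ) + t * Complex.I).re = a := by simp
  have hne (t : ℝ) : (a : ℂ) + t * Complex.I ≠ 0 := fun h ↦ by
    have := congrArg Complex.re h
    rw [hre, Complex.zero_re] at this
    exact ha.ne' this
  have hne' (t : ℝ) : (a : ℂ) + t * Complex.I + 1 ≠ 0 := fun h ↦ by
    have := congrArg Complex.re h
    rw [Complex.add_re, hre, Complex.zero_re, Complex.one_re] at this
    linarith
  refine (integrable_inv_one_add_sq.const_mul (1 + 1 / a ^ 2)).mono' ?_ (.of_forall fun t ↦ ?_)
  · refine Continuous.aestronglyMeasurable (continuous_const.div (by fun_prop) fun t ↦ ?_)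
    exact mul_ne_zero (hne t) (hne' t)
  · have h1 : ‖(a : ℂ) + t * Complex.I‖ ^ 2 = a ^ 2 + t ^ 2 := by
      rw [Complex.sq_norm, Complex.normSq_add_mul_I]
    have h2 : ‖(a : ℂ) + t * Complex.I‖ ≤ ‖(a : ℂ) + t * Complex.I + 1‖ := by
      rw [← sq_le_sq₀ (norm_nonneg _) (norm_nonneg _), h1, Complex.sq_norm,
        show (a : ℂ) + t * Complex.I + 1 = ((a + 1 : ℝ) : ℂ) + t * Complex.I by push_cast; ring,
        Complex.normSq_add_mul_I]
      nlinarith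
    have h3 : 0 < a ^ 2 + t ^ 2 := by positivity
    rw [norm_div, norm_one, norm_mul, ← div_eq_mul_inv,
      div_le_div_iff₀ (mul_pos (norm_pos_iff.2 (hne t)) (norm_pos_iff.2 (hne' t))) (by positivity)]
    calc 1 * (1 + t ^ 2) ≤ (1 + 1 / a ^ 2) * (a ^ 2 + t ^ 2) := by
          have h4 : 1 / a ^ 2 * a ^ 2 = 1 := by field_simp
          have h5 : 0 ≤ 1 / a ^ 2 * t ^ 2 := by positivity
          nlinarith [sq_nonneg a]
      _ ≤ _ := by
          rw [← h1, sq ‖_‖]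
          exact mul_le_mul_of_nonneg_left (mul_le_mul_of_nonneg_left h2 (norm_nonneg _))
            (by positivity)

/-- The Mellin transform of `t ↦ max (1 - t) 0` is `s ↦ 1 / (s (s + 1))`. -/
lemma hasMellin_max_one_sub {s : ℂ} (hs : 0 < s.re) :
    HasMellin (fun t : ℝ ↦ ((max (1 - t) 0 : ℝ) : ℂ)) s (1 / (s * (s + 1))) := by
  have h1 := hasMellin_one_Ioc hs
  have h2 := hasMellin_cpow_Ioc 1 (s := s) (by simp; linarith)
  have h := hasMellin_sub h1.1 h2.1
  rw [h1.2, h2.2] at h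
  have hs0 : s ≠ 0 := fun h0 ↦ by simp [h0] at hs
  have hs1 : s + 1 ≠ 0 := fun h0 ↦ by
    have := congrArg Complex.re h0
    simp at this
    linarith
  have hval : 1 / s - 1 / (s + 1) = 1 / (s * (s + 1)) := by field_simp; ring
  rw [hval] at h
  have heq : Set.EqOn (fun t : ℝ ↦ (t : ℂ) ^ (s - 1) •
      (Set.indicator (Set.Ioc 0 1) (fun _ ↦ 1 : ℝ → ℂ) t -
        Set.indicator (Set.Ioc 0 1) (fun t ↦ (t : ℂ) ^ (1 : ℂ) : ℝ → ℂ) t))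
      (fun t : ℝ ↦ (t : ℂ) ^ (s - 1) • ((max (1 - t) 0 : ℝ) : ℂ)) (Set.Ioi 0) := by
    intro t ht
    have ht0 : 0 < t := ht
    simp only [Set.indicator_apply, Set.mem_Ioc, ht0, true_and]
    split_ifs with h1
    · rw [max_eq_left (by linarith)]
      simp
    · rw [max_eq_right (by linarith)]
      simp
  refine ⟨?_, ?_⟩
  · exact h.1.congr_fun heq measurableSet_Ioi
  · rw [← h.2]
    exact (setIntegral_congr_fun measurableSet_Ioi heq).symm

/-- Perron's formula with the weight `1 / (w (w + 1))`. -/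
lemma integral_cpow_div_mul_add_one {a y : ℝ} (ha : 0 < a) (hy : 0 < y) :
    (1 / (2 * π) : ℂ) * ∫ t : ℝ, (y : ℂ) ^ ((a : ℂ) + t * Complex.I) *
      (1 / (((a : ℂ) + t * Complex.I) * (((a : ℂ) + t * Complex.I) + 1))) =
      ((max (1 - y⁻¹) 0 : ℝ) : ℂ) := by
  have hm (t : ℝ) := hasMellin_max_one_sub (s := (a : ℂ) + t * Complex.I) (by simpa using ha)
  have key := mellinInv_mellin_eq a (fun t : ℝ ↦ ((max (1 - t) 0 : ℝ) : ℂ)) (inv_pos.2 hy)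
    (hasMellin_max_one_sub (by simpa using ha)).1
    (by
      rw [VerticalIntegrable]
      simp_rw [(hm _).2]
      exact integrable_perron_weight ha)
    (by fun_prop)
  rw [← key, mellinInv, Complex.real_smul]
  push_cast
  congr 1
  refine integral_congr_ae (.of_forall fun t ↦ ?_)
  simp only [(hm t).2, smul_eq_mul]
  rw [Complex.cpow_neg, Complex.inv_cpow, inv_inv]
  rw [Complex.arg_ofReal_of_nonneg hy.le]
  exact pi_pos.ne

/-- The halved boundary term vanishes, so the primed sum is a sum with truncated weights. -/
lemma primedSum_mul_sub (f : ℕ → ℂ) {z : ℝ} (hz : 0 ≤ z) :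
    primedSum (fun n ↦ f n * ((z - n : ℝ) : ℂ)) z =
      ∑' n : ℕ, f (n + 1) * ((max (z - (n + 1 : ℕ)) 0 : ℝ) : ℂ) := by
  have hsum : primedSum (fun n ↦ f n * ((z - n : ℝ) : ℂ)) z =
      ∑ n ∈ Finset.Icc 1 ⌊z⌋₊, f n * ((max (z - n) 0 : ℝ) : ℂ) := by
    refine Finset.sum_congr rfl fun n hn ↦ ?_
    have hnz : (n : ℝ) ≤ z := (Nat.le_floor_iff hz).1 (Finset.mem_Icc.1 hn).2
    rw [max_eq_left (by linarith)]
    split_ifs with h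
    · simp [h]
    · rfl
  rw [hsum, tsum_eq_sum (s := Finset.range ⌊z⌋₊), Finset.range_eq_Ico,
    Finset.sum_Ico_add' (fun n : ℕ ↦ f n * ((max (z - n) 0 : ℝ) : ℂ)) 0 ⌊z⌋₊ 1]
  · rfl
  · intro n hn
    rw [Finset.mem_range, not_lt] at hn
    have := (Nat.floor_lt hz).1 (Nat.lt_succ_of_le hn)
    rw [max_eq_right (by push_cast at this ⊢; linarith)]
    simp

/-- A Dirichlet series with coefficients `O(n ^ c)` converges absolutely for `c + 1 < re s`. -/
lemma summable_norm_div_cpow {c : ℝ} {α : ℕ → ℂ}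
    (hα : ∃ C : ℝ, ∀ n : ℕ, 1 ≤ n → ‖α n‖ ≤ C * (n : ℝ) ^ c) {s : ℂ} (hs : c + 1 < s.re) :
    Summable fun n : ℕ ↦ ‖α (n + 1) / ((n : ℂ) + 1) ^ s‖ := by
  obtain ⟨C, hC⟩ := hα
  have h := (summable_nat_add_iff 1).2
    ((Real.summable_nat_rpow (p := c - s.re)).2 (by linarith)) |>.mul_left C
  refine h.of_nonneg_of_le (fun _ ↦ norm_nonneg _) fun n ↦ ?_
  have hn : (0 : ℝ) < (n + 1 : ℕ) := by positivity
  rw [norm_div, ← Nat.cast_add_one, Complex.norm_natCast_cpow_of_pos n.succ_pos,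
    Real.rpow_sub hn, ← mul_div_assoc]
  gcongr
  exact hC (n + 1) (by omega)

/-- Each term of the product of two Dirichlet series, times `x ^ (w + 1)`, is a power of a single
positive real number. -/
lemma mul_cpow_term_eq {N M x : ℝ} (hN : 0 < N) (hM : 0 < M) (hx : 0 < x) (A B u v w : ℂ) :
    A / (N : ℂ) ^ (u + w) * (B / (M : ℂ) ^ (v - w)) * (x : ℂ) ^ (w + 1) =
      A / (N : ℂ) ^ u * (B / (M : ℂ) ^ v) * x * ((M * x / N : ℝ) : ℂ) ^ w := by
  have hN' : (N : ℂ) ≠ 0 := mod_cast hN.ne'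
  have hM' : (M : ℂ) ≠ 0 := mod_cast hM.ne'
  have hx' : (x : ℂ) ≠ 0 := mod_cast hx.ne'
  have hy : ((M * x / N : ℝ) : ℂ) ^ w = (M : ℂ) ^ w * (x : ℂ) ^ w / (N : ℂ) ^ w := by
    rw [div_eq_mul_inv, Complex.ofReal_mul, Complex.mul_cpow_ofReal_nonneg (by positivity)
      (by positivity), Complex.ofReal_mul, Complex.mul_cpow_ofReal_nonneg hM.le hx.le,
      Complex.ofReal_inv, Complex.inv_cpow, div_eq_mul_inv]
    rw [Complex.arg_ofReal_of_nonneg hN.le]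
    exact pi_pos.ne
  rw [hy, Complex.cpow_add _ _ hN', Complex.cpow_sub _ _ hM', Complex.cpow_add _ _ hx',
    Complex.cpow_one]
  have h1 (z : ℂ) : (N : ℂ) ^ z ≠ 0 := by simp [Complex.cpow_eq_zero_iff, hN']
  have h2 (z : ℂ) : (M : ℂ) ^ z ≠ 0 := by simp [Complex.cpow_eq_zero_iff, hM']
  field_simp [h1, h2]

/-- Perron-type evaluation of
`(1/2πi) ∫_{a-i∞}^{a+i∞} φ(u+w) ψ(v-w) x^{w+1}/(w(w+1)) dw`
(the contour integral along the vertical line `Re w = a` is parametrized as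
`w = a + it`, so that `(1/2πi)∫ dw = (1/2π) ∫_ℝ dt`). -/
theorem perron_formula_for_products
    (c : ℝ) (α β : ℕ → ℂ) (hc : 0 ≤ c)
    (hα : ∃ C : ℝ, ∀ n : ℕ, 1 ≤ n → ‖α n‖ ≤ C * (n : ℝ) ^ c)
    (hβ : ∃ C : ℝ, ∀ n : ℕ, 1 ≤ n → ‖β n‖ ≤ C * (n : ℝ) ^ c)
    (a x : ℝ) (ha : 0 < a) (hx : 0 < x)
    (u v : ℂ) (hu : c + 1 + a < u.re) (hv : c + 1 + a < v.re) :
    (1 / (2 * π) : ℂ) *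
        ∫ t : ℝ, dseries α (u + ((a : ℂ) + t * Complex.I)) *
          dseries β (v - ((a : ℂ) + t * Complex.I)) *
          (x : ℂ) ^ (((a : ℂ) + t * Complex.I) + 1) /
          (((a : ℂ) + t * Complex.I) * (((a : ℂ) + t * Complex.I) + 1)) =
      ∑' m : ℕ, (β (m + 1) / ((m : ℂ) + 1) ^ (v + 1)) *
        primedSum
          (fun n => α n / (n : ℂ) ^ u * (((((m : ℝ) + 1) * x - n : ℝ)) : ℂ))
          (((m : ℝ) + 1) * x) := by
  set W : ℝ → ℂ := fun t ↦
    1 / (((a : ℂ) + t * Complex.I) * (((a : ℂ) + t * Complex.I) + 1)) with hW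
  have hWint : Integrable W := integrable_perron_weight ha
  set A : ℂ → ℕ → ℂ := fun s n ↦ α (n + 1) / ((n : ℂ) + 1) ^ s with hA
  set B : ℂ → ℕ → ℂ := fun s m ↦ β (m + 1) / ((m : ℂ) + 1) ^ s with hB
  set F : ℕ × ℕ → ℝ → ℂ := fun p t ↦
    A (u + ((a : ℂ) + t * Complex.I)) p.2 * B (v - ((a : ℂ) + t * Complex.I)) p.1 *
      (x : ℂ) ^ (((a : ℂ) + t * Complex.I) + 1) * W t with hF
  have hsA {s : ℂ} (hs : c + 1 < s.re) : Summable fun n ↦ ‖A s n‖ := summable_norm_div_cpow hα hs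
  have hsB {s : ℂ} (hs : c + 1 < s.re) : Summable fun m ↦ ‖B s m‖ := summable_norm_div_cpow hβ hs
  have hFK (p : ℕ × ℕ) (t : ℝ) : F p t = A u p.2 * B v p.1 * x *
      ((((((p.1 : ℝ) + 1) * x / ((p.2 : ℝ) + 1) : ℝ) : ℂ)) ^ ((a : ℂ) + t * Complex.I) * W t) := by
    have h := mul_cpow_term_eq (N := (p.2 : ℝ) + 1) (M := (p.1 : ℝ) + 1) (by positivity)
      (by positivity) hx (α (p.2 + 1)) (β (p.1 + 1)) u v ((a : ℂ) + t * Complex.I)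
    simp only [hF, hA, hB]
    rw [← mul_assoc]
    congr 1
    simpa using h
  have hnorm (p : ℕ × ℕ) (t : ℝ) :
      ‖F p t‖ = ‖B (v - a) p.1‖ * ‖A (u + a) p.2‖ * (x ^ (a + 1) * ‖W t‖) := by
    have h (n : ℕ) (s : ℂ) : ‖((n : ℂ) + 1) ^ s‖ = ((n + 1 : ℕ) : ℝ) ^ s.re := by
      rw [← Nat.cast_add_one, Complex.norm_natCast_cpow_of_pos n.succ_pos]
    simp only [hF, hA, hB, norm_mul, norm_div, h, Complex.norm_cpow_eq_rpow_re_of_pos hx]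
    simp
    ring
  have hFint (p : ℕ × ℕ) : Integrable (F p) := by
    have hy : 0 < ((p.1 : ℝ) + 1) * x / ((p.2 : ℝ) + 1) := by positivity
    simp only [funext (hFK p)]
    refine (hWint.bdd_mul (c := (((p.1 : ℝ) + 1) * x / ((p.2 : ℝ) + 1)) ^ a) ?_
      (.of_forall fun t ↦ ?_)).const_mul _
    · refine Continuous.aestronglyMeasurable (Continuous.const_cpow (by fun_prop) ?_)
      exact .inl (mod_cast hy.ne')
    · rw [Complex.norm_cpow_eq_rpow_re_of_pos hy]
      simp
  have hFsum : Summable fun p ↦ ∫ t, ‖F p t‖ := by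
    simp_rw [hnorm, integral_const_mul]
    exact ((hsB (by simp; linarith)).mul_of_nonneg (hsA (by simp; linarith))
      (fun _ ↦ norm_nonneg _) fun _ ↦ norm_nonneg _).mul_right _
  have hprod (t : ℝ) : dseries α (u + ((a : ℂ) + t * Complex.I)) *
      dseries β (v - ((a : ℂ) + t * Complex.I)) * (x : ℂ) ^ (((a : ℂ) + t * Complex.I) + 1) /
      (((a : ℂ) + t * Complex.I) * (((a : ℂ) + t * Complex.I) + 1)) = ∑' p, F p t := by
    simp only [hF]
    rw [tsum_mul_right, tsum_mul_right]
    simp_rw [mul_comm (A _ _)]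
    rw [← tsum_mul_tsum_of_summable_norm (hsB (by simp; linarith)) (hsA (by simp; linarith)),
      mul_comm (tsum _), ← div_eq_mul_one_div]
    rfl
  have hFval (p : ℕ × ℕ) : (1 / (2 * π) : ℂ) * ∫ t, F p t =
      B (v + 1) p.1 * (A u p.2 *
        ((max (((p.1 : ℝ) + 1) * x - (p.2 + 1 : ℕ)) 0 : ℝ) : ℂ)) := by
    have hM : 0 < (p.1 : ℝ) + 1 := by positivity
    have hN : 0 < (p.2 : ℝ) + 1 := by positivity
    have hM' : (p.1 : ℂ) + 1 ≠ 0 := mod_cast hM.ne'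
    simp_rw [hFK p]
    rw [integral_const_mul, mul_left_comm, integral_cpow_div_mul_add_one ha (by positivity)]
    have hmax : max (((p.1 : ℝ) + 1) * x - (p.2 + 1 : ℕ)) 0 =
        ((p.1 : ℝ) + 1) * x * max (1 - (((p.1 : ℝ) + 1) * x / ((p.2 : ℝ) + 1))⁻¹) 0 := by
      rw [mul_max_of_nonneg _ _ (by positivity), mul_zero]
      congr 1
      push_cast
      field_simp
    rw [hmax]
    simp only [hB, Complex.cpow_add _ _ hM', Complex.cpow_one]
    push_cast
    field_simp
  have hsum := hasSum_integral_of_summable_integral_norm hFint hFsum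
  have hsum' := hsum.mul_left (1 / (2 * π) : ℂ)
  simp_rw [hprod]
  rw [← hsum'.tsum_eq, hsum'.summable.tsum_prod]
  refine tsum_congr fun m ↦ ?_
  simp_rw [hFval]
  rw [tsum_mul_left, primedSum_mul_sub _ (by positivity)]
  simp only [hA, hB, Nat.cast_add_one]
end
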